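/- arXiv:1011.1690 — 2 statements merged into one kernel-verified Lean document; each statement's English description precedes it below -/
import Mathlib

section
/- Calderón–Zygmund inequality: For each real number p with 1 < p < ∞ there is a constant c > 0 such that for every smooth function u : ℂ → ℂⁿ with compact support contained in the open unit ball B, one has ‖u‖_{L^p} + ‖Du‖_{L^p} ≤ c·‖∂̄u‖_{L^p}, where Du(z) denotes the real Fréchet derivative of u at z measured in the operator norm, ∂̄u = ∂ₛu + i·∂ₜu, and the L^p norms are taken with respect to Lebesgue measure on ℂ. -/
open Metric Complex MeasureTheory

namespace HeatFlow

open Set Filter Topology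

/-- The open upper half of space-time `ℂ × ℝ`. -/
def upper : Set (ℂ × ℝ) := {x | 0 < x.2}

lemma isOpen_upper : IsOpen upper := isOpen_lt continuous_const continuous_snd

/-- Differentiation under the integral sign for integrands supported in a fixed compact set. -/
lemma hasDerivAt_integral_of_isCompact {F F' : ℝ → ℂ → ℝ} {a b s₀ : ℝ} {K : Set ℂ}
    (hs₀ : s₀ ∈ Ioo a b) (hK : IsCompact K)
    (hF0 : ∀ s ∈ Ioo a b, ∀ w ∉ K, F s w = 0) (hF'0 : ∀ s ∈ Ioo a b, ∀ w ∉ K, F' s w = 0)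
    (hF : ∀ s ∈ Ioo a b, Continuous (F s))
    (hF' : ContinuousOn (Function.uncurry F') (Ioo a b ×ˢ univ))
    (hd : ∀ s ∈ Ioo a b, ∀ w, HasDerivAt (fun s => F s w) (F' s w) s) :
    HasDerivAt (fun s => ∫ w, F s w) (∫ w, F' s₀ w) s₀ := by
  obtain ⟨ε, hε, hεs⟩ : ∃ ε > 0, closedBall s₀ ε ⊆ Ioo a b :=
    nhds_basis_closedBall.mem_iff.1 (isOpen_Ioo.mem_nhds hs₀)
  obtain ⟨C, hC⟩ := ((isCompact_closedBall s₀ ε).prod hK).exists_bound_of_continuousOn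
    (hF'.mono (prod_mono hεs (subset_univ _)))
  have hslice : ∀ s ∈ Ioo a b, Continuous (F' s) := fun s hs =>
    continuousOn_univ.1 (hF'.comp (f := fun w => (s, w)) (by fun_prop)
      (fun w _ => ⟨hs, mem_univ w⟩))
  refine (hasDerivAt_integral_of_dominated_loc_of_deriv_le (s := closedBall s₀ ε)
    (bound := K.indicator fun _ => C) (closedBall_mem_nhds _ hε) ?_ ?_ ?_ ?_ ?_ ?_).2
  · filter_upwards [isOpen_Ioo.mem_nhds hs₀] with s hs using (hF s hs).aestronglyMeasurable
  · exact (hF s₀ hs₀).integrable_of_hasCompactSupport (HasCompactSupport.intro hK (hF0 s₀ hs₀))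
  · exact (hslice s₀ hs₀).aestronglyMeasurable
  · refine ae_of_all _ fun w s hs => ?_
    by_cases hw : w ∈ K
    · simpa [hw] using hC (s, w) ⟨hs, hw⟩
    · simp [hw, hF'0 s (hεs hs) w hw]
  · exact (integrable_indicator_iff hK.measurableSet).2
      (integrableOn_const hK.measure_lt_top.ne)
  · exact ae_of_all _ fun w s hs => hd s (hεs hs) w

lemma hasDerivAt_of_eq {f g : ℝ → ℝ} {f' g' x : ℝ} (h : HasDerivAt f f' x) (hfg : ∀ s, g s = f s)
    (hd : g' = f') : HasDerivAt g g' x := by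
  rwa [funext hfg, hd]

/-- Spatial convolution of `φ` with a space-time kernel. -/
noncomputable def kernelConv (k : ℂ × ℝ → ℝ) (φ : ℂ → ℝ) (x : ℂ × ℝ) : ℝ :=
  ∫ w, φ w * k (x.1 - w, x.2)

lemma contDiffOn_kernelConv {k : ℂ × ℝ → ℝ} (hk : ContDiffOn ℝ (⊤ : ℕ∞) k upper) {φ : ℂ → ℝ}
    (hφ : Continuous φ) (hs : HasCompactSupport φ) :
    ContDiffOn ℝ (⊤ : ℕ∞) (kernelConv k φ) upper := by
  obtain ⟨R, hR, hφR⟩ := hs.isBounded.subset_ball_lt 0 0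
  let χ : ContDiffBump (0 : ℂ) := ⟨R, R + 1, hR, by linarith⟩
  have key := contDiffOn_convolution_right_with_param_comp (𝕜 := ℝ) (μ := (volume : Measure ℂ))
    (n := (⊤ : ℕ∞)) (ContinuousLinearMap.mul ℝ ℝ) (s := upper) (v := fun _ : ℂ × ℝ => (0 : ℂ))
    contDiffOn_const (f := φ) (g := fun x y => k (x.1 + y, x.2) * χ y)
    (k := closedBall 0 (R + 1)) isOpen_upper (isCompact_closedBall _ _)
    (fun x y _ hy => by
      rw [χ.zero_of_le_dist (by simpa [χ] using (not_le.1 (fun h => hy (by simpa using h))).le),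
        mul_zero])
    (hφ.locallyIntegrable) (by
      refine ContDiffOn.mul (f := fun q : (ℂ × ℝ) × ℂ => k (q.1.1 + q.2, q.1.2))
        (g := fun q : (ℂ × ℝ) × ℂ => χ q.2) ?_ ?_
      · exact hk.comp (ContDiff.contDiffOn (by fun_prop)) (fun q hq => hq.1)
      · exact (χ.contDiff.comp contDiff_snd).contDiffOn)
  refine key.congr fun x _ => ?_
  simp only [kernelConv, convolution_def, ContinuousLinearMap.mul_apply', zero_sub]
  refine integral_congr_ae (ae_of_all _ fun w => ?_)
  by_cases hw : φ w = 0
  · simp [hw]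
  · have hw' : w ∈ ball (0 : ℂ) R := hφR (subset_tsupport _ hw)
    have : χ (-w) = 1 := χ.one_of_mem_closedBall (by simpa [χ] using (mem_ball_zero_iff.1 hw').le)
    simp [this, sub_eq_add_neg]

lemma hasLineDerivAt_of_contDiffOn {f : ℂ × ℝ → ℝ} (hf : ContDiffOn ℝ (⊤ : ℕ∞) f upper)
    {x : ℂ × ℝ} (hx : x ∈ upper) (v : ℂ × ℝ) :
    HasLineDerivAt ℝ f (lineDeriv ℝ f x v) x v :=
  ((hf.contDiffAt (isOpen_upper.mem_nhds hx)).differentiableAt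
    (by simp)).lineDifferentiableAt.hasLineDerivAt

lemma contDiffOn_lineDeriv {f : ℂ × ℝ → ℝ} (hf : ContDiffOn ℝ (⊤ : ℕ∞) f upper) (v : ℂ × ℝ) :
    ContDiffOn ℝ (⊤ : ℕ∞) (fun x => lineDeriv ℝ f x v) upper := by
  have h : ContDiffOn ℝ (⊤ : ℕ∞) (fun x => fderiv ℝ f x v) upper :=
    (hf.fderiv_of_isOpen isOpen_upper (m := (⊤ : ℕ∞)) (by simp)).clm_apply contDiffOn_const
  refine h.congr fun x hx => ?_
  exact ((hf.contDiffAt (isOpen_upper.mem_nhds hx)).differentiableAt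
    (by simp)).lineDeriv_eq_fderiv

/-- A line derivative at `x + s • v` differentiates the restriction to the line at `s`. -/
lemma HasLineDerivAt.hasDerivAt_line {E : Type*} [NormedAddCommGroup E] [NormedSpace ℝ E]
    {f : E → ℝ} {f' : ℝ} {x v : E} {s : ℝ} (h : HasLineDerivAt ℝ f f' (x + s • v) v) :
    HasDerivAt (fun s => f (x + s • v)) f' s := by
  have h' : HasDerivAt (fun t : ℝ => f (x + s • v + t • v)) f' (s - s) := by rw [sub_self]; exact h
  have := h'.comp_sub_const s s
  refine this.congr_of_eventuallyEq (Eventually.of_forall fun t => ?_)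
  show f _ = f _
  congr 1
  module

lemma hasLineDerivAt_kernelConv {k : ℂ × ℝ → ℝ} (hk : ContDiffOn ℝ (⊤ : ℕ∞) k upper) {φ : ℂ → ℝ}
    (hφ : Continuous φ) (hs : HasCompactSupport φ) {x : ℂ × ℝ} (hx : x ∈ upper) (v : ℂ × ℝ) :
    HasLineDerivAt ℝ (kernelConv k φ) (kernelConv (fun y => lineDeriv ℝ k y v) φ x) x v := by
  have hline : Continuous fun s : ℝ => x + s • v := by fun_prop
  obtain ⟨ε, hε, hεs⟩ : ∃ ε > 0, ball (0 : ℝ) ε ⊆ (fun s : ℝ => x + s • v) ⁻¹' upper :=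
    Metric.mem_nhds_iff.1 ((isOpen_upper.preimage hline).mem_nhds (by simpa using hx))
  rw [Real.ball_eq_Ioo, zero_sub, zero_add] at hεs
  have hmem : ∀ s ∈ Ioo (-ε) ε, ∀ w : ℂ, ((x + s • v).1 - w, (x + s • v).2) ∈ upper :=
    fun s hs w => hεs hs
  have hk' := contDiffOn_lineDeriv hk v
  have := hasDerivAt_integral_of_isCompact (a := -ε) (b := ε) (s₀ := 0) (K := tsupport φ)
    (F := fun s w => φ w * k ((x + s • v).1 - w, (x + s • v).2))
    (F' := fun s w => φ w * lineDeriv ℝ k ((x + s • v).1 - w, (x + s • v).2) v)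
    (by simpa using hε) hs (fun s _ w hw => by simp [image_eq_zero_of_notMem_tsupport hw])
    (fun s _ w hw => by simp [image_eq_zero_of_notMem_tsupport hw])
    (fun s hs => hφ.mul (continuousOn_univ.1 (hk.continuousOn.comp (by fun_prop)
      (fun w _ => hmem s hs w))))
    (by
      refine ContinuousOn.mul (by fun_prop) (hk'.continuousOn.comp (by fun_prop) ?_)
      exact fun q hq => hmem q.1 hq.1 q.2)
    (fun s hs w => by
      refine HasDerivAt.const_mul (φ w) ?_
      have h1 := hasLineDerivAt_of_contDiffOn hk (hmem s hs w) v
      have e : ∀ t : ℝ, ((x + t • v).1 - w, (x + t • v).2) = (x - (w, 0)) + t • v := by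
        intro t; ext1 <;> simp [sub_add_eq_add_sub]
      simp only [e] at h1 ⊢
      exact HasLineDerivAt.hasDerivAt_line h1)
  simp only [zero_smul, add_zero] at this
  exact this

/-- The heat kernel on the plane. -/
noncomputable def heatKernel (x : ℂ × ℝ) : ℝ :=
  (4 * Real.pi * x.2)⁻¹ * Real.exp (-(x.1.re ^ 2 + x.1.im ^ 2) / (4 * x.2))

/-- The caloric extension of `φ` to the upper half of space-time. -/
noncomputable def heatExt (φ : ℂ → ℝ) : ℂ × ℝ → ℝ := kernelConv heatKernel φ

/-- The Laplacian in the space variable. -/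
noncomputable def spaceLaplacian (f : ℂ × ℝ → ℝ) (x : ℂ × ℝ) : ℝ :=
  lineDeriv ℝ (fun y => lineDeriv ℝ f y (1, 0)) x (1, 0) +
    lineDeriv ℝ (fun y => lineDeriv ℝ f y (I, 0)) x (I, 0)

lemma contDiffOn_heatKernel : ContDiffOn ℝ (⊤ : ℕ∞) heatKernel upper := by
  have hre : ContDiff ℝ (⊤ : ℕ∞) (fun x : ℂ × ℝ => x.1.re) := reCLM.contDiff.comp contDiff_fst
  have him : ContDiff ℝ (⊤ : ℕ∞) (fun x : ℂ × ℝ => x.1.im) := imCLM.contDiff.comp contDiff_fst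
  have ht : ContDiff ℝ (⊤ : ℕ∞) (fun x : ℂ × ℝ => x.2) := contDiff_snd
  refine ContDiffOn.mul (ContDiffOn.inv (by fun_prop) fun x hx => ?_)
    (Real.contDiff_exp.comp_contDiffOn (ContDiffOn.div (by fun_prop) (by fun_prop) fun x hx => ?_))
  · have : 0 < x.2 := hx
    positivity
  · have : 0 < x.2 := hx
    positivity

lemma lineDeriv_heatKernel_one {x : ℂ × ℝ} (hx : x ∈ upper) :
    lineDeriv ℝ heatKernel x (1, 0) = -(x.1.re / (2 * x.2)) * heatKernel x := by
  have hx' : (0 : ℝ) < x.2 := hx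
  have h : HasLineDerivAt ℝ heatKernel (-(x.1.re / (2 * x.2)) * heatKernel x) x (1, 0) := by
    have h0 : HasDerivAt (fun s : ℝ => -((x.1.re + s) ^ 2 + x.1.im ^ 2) / (4 * x.2))
        (-(x.1.re / (2 * x.2))) 0 := by
      have := (((((hasDerivAt_id (0 : ℝ)).const_add x.1.re).pow 2).add_const
        (x.1.im ^ 2)).neg).div_const (4 * x.2)
      exact hasDerivAt_of_eq this (fun _ => rfl) (by simp; field_simp; norm_num)
    have := (h0.exp).const_mul (4 * Real.pi * x.2)⁻¹
    exact hasDerivAt_of_eq this (fun s => by simp [heatKernel])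
      (by simp only [heatKernel, add_zero]; ring)
  exact h.lineDeriv

lemma lineDeriv_heatKernel_I {x : ℂ × ℝ} (hx : x ∈ upper) :
    lineDeriv ℝ heatKernel x (I, 0) = -(x.1.im / (2 * x.2)) * heatKernel x := by
  have hx' : (0 : ℝ) < x.2 := hx
  have h : HasLineDerivAt ℝ heatKernel (-(x.1.im / (2 * x.2)) * heatKernel x) x (I, 0) := by
    have h0 : HasDerivAt (fun s : ℝ => -(x.1.re ^ 2 + (x.1.im + s) ^ 2) / (4 * x.2))
        (-(x.1.im / (2 * x.2))) 0 := by
      have := (((((hasDerivAt_id (0 : ℝ)).const_add x.1.im).pow 2).const_add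
        (x.1.re ^ 2)).neg).div_const (4 * x.2)
      exact hasDerivAt_of_eq this (fun _ => rfl) (by simp; field_simp; norm_num)
    have := (h0.exp).const_mul (4 * Real.pi * x.2)⁻¹
    exact hasDerivAt_of_eq this (fun s => by simp [heatKernel])
      (by simp only [heatKernel, add_zero]; ring)
  exact h.lineDeriv

lemma lineDeriv_heatKernel_time {x : ℂ × ℝ} (hx : x ∈ upper) :
    lineDeriv ℝ heatKernel x (0, 1) =
      ((x.1.re ^ 2 + x.1.im ^ 2) / (4 * x.2 ^ 2) - 1 / x.2) * heatKernel x := by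
  have hx' : (0 : ℝ) < x.2 := hx
  have h : HasLineDerivAt ℝ heatKernel
      (((x.1.re ^ 2 + x.1.im ^ 2) / (4 * x.2 ^ 2) - 1 / x.2) * heatKernel x) x (0, 1) := by
    have h1 : HasDerivAt (fun s : ℝ => 4 * (x.2 + s)) 4 0 := by
      simpa using ((hasDerivAt_id (0 : ℝ)).const_add x.2).const_mul 4
    have h2 : HasDerivAt (fun s : ℝ => 4 * Real.pi * (x.2 + s)) (4 * Real.pi) 0 := by
      simpa using ((hasDerivAt_id (0 : ℝ)).const_add x.2).const_mul (4 * Real.pi)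
    have h3 := ((hasDerivAt_const (0 : ℝ) (-(x.1.re ^ 2 + x.1.im ^ 2))).div h1
      (by simp [hx'.ne'])).exp
    have h4 := (h2.inv (by simp [hx'.ne', Real.pi_ne_zero])).mul h3
    refine hasDerivAt_of_eq h4 (fun s => by simp [heatKernel]) ?_
    simp only [heatKernel, add_zero, Pi.inv_apply, Pi.div_apply]
    field_simp
    ring
  exact h.lineDeriv

lemma spaceLaplacian_heatKernel {x : ℂ × ℝ} (hx : x ∈ upper) :
    spaceLaplacian heatKernel x = lineDeriv ℝ heatKernel x (0, 1) := by
  have hx' : (0 : ℝ) < x.2 := hx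
  have e1 : (fun y => lineDeriv ℝ heatKernel y (1, 0)) =ᶠ[𝓝 x]
      fun y => -(y.1.re / (2 * y.2)) * heatKernel y := by
    filter_upwards [isOpen_upper.mem_nhds hx] with y hy using lineDeriv_heatKernel_one hy
  have e2 : (fun y => lineDeriv ℝ heatKernel y (I, 0)) =ᶠ[𝓝 x]
      fun y => -(y.1.im / (2 * y.2)) * heatKernel y := by
    filter_upwards [isOpen_upper.mem_nhds hx] with y hy using lineDeriv_heatKernel_I hy
  have d1 : HasLineDerivAt ℝ (fun y : ℂ × ℝ => -(y.1.re / (2 * y.2)) * heatKernel y)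
      (-(1 / (2 * x.2)) * heatKernel x +
        -(x.1.re / (2 * x.2)) * (-(x.1.re / (2 * x.2)) * heatKernel x)) x (1, 0) := by
    have hk := hasLineDerivAt_of_contDiffOn contDiffOn_heatKernel hx (1, 0)
    rw [lineDeriv_heatKernel_one hx] at hk
    have h0 : HasDerivAt (fun s : ℝ => -((x.1.re + s) / (2 * x.2))) (-(1 / (2 * x.2))) 0 :=
      (((hasDerivAt_id (0 : ℝ)).const_add x.1.re).div_const (2 * x.2)).neg
    exact hasDerivAt_of_eq (h0.mul hk) (fun s => by simp) (by simp)
  have d2 : HasLineDerivAt ℝ (fun y : ℂ × ℝ => -(y.1.im / (2 * y.2)) * heatKernel y)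
      (-(1 / (2 * x.2)) * heatKernel x +
        -(x.1.im / (2 * x.2)) * (-(x.1.im / (2 * x.2)) * heatKernel x)) x (I, 0) := by
    have hk := hasLineDerivAt_of_contDiffOn contDiffOn_heatKernel hx (I, 0)
    rw [lineDeriv_heatKernel_I hx] at hk
    have h0 : HasDerivAt (fun s : ℝ => -((x.1.im + s) / (2 * x.2))) (-(1 / (2 * x.2))) 0 :=
      (((hasDerivAt_id (0 : ℝ)).const_add x.1.im).div_const (2 * x.2)).neg
    exact hasDerivAt_of_eq (h0.mul hk) (fun s => by simp) (by simp)
  rw [spaceLaplacian, e1.lineDeriv_eq, e2.lineDeriv_eq, d1.lineDeriv, d2.lineDeriv,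
    lineDeriv_heatKernel_time hx]
  field_simp
  ring

lemma lineDeriv_kernelConv {k : ℂ × ℝ → ℝ} (hk : ContDiffOn ℝ (⊤ : ℕ∞) k upper) {φ : ℂ → ℝ}
    (hφ : Continuous φ) (hs : HasCompactSupport φ) {x : ℂ × ℝ} (hx : x ∈ upper) (v : ℂ × ℝ) :
    lineDeriv ℝ (kernelConv k φ) x v = kernelConv (fun y => lineDeriv ℝ k y v) φ x :=
  (hasLineDerivAt_kernelConv hk hφ hs hx v).lineDeriv

lemma lineDeriv_lineDeriv_kernelConv {k : ℂ × ℝ → ℝ} (hk : ContDiffOn ℝ (⊤ : ℕ∞) k upper)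
    {φ : ℂ → ℝ} (hφ : Continuous φ) (hs : HasCompactSupport φ) {x : ℂ × ℝ} (hx : x ∈ upper)
    (v : ℂ × ℝ) :
    lineDeriv ℝ (fun y => lineDeriv ℝ (kernelConv k φ) y v) x v =
      kernelConv (fun y => lineDeriv ℝ (fun z => lineDeriv ℝ k z v) y v) φ x := by
  have e : (fun y => lineDeriv ℝ (kernelConv k φ) y v) =ᶠ[𝓝 x]
      kernelConv (fun y => lineDeriv ℝ k y v) φ := by
    filter_upwards [isOpen_upper.mem_nhds hx] with y hy using lineDeriv_kernelConv hk hφ hs hy v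
  rw [e.lineDeriv_eq, lineDeriv_kernelConv (contDiffOn_lineDeriv hk v) hφ hs hx v]

lemma integrable_mul_kernel {k : ℂ × ℝ → ℝ} (hk : ContinuousOn k upper) {φ : ℂ → ℝ}
    (hφ : Continuous φ) (hs : HasCompactSupport φ) {x : ℂ × ℝ} (hx : x ∈ upper) :
    Integrable fun w => φ w * k (x.1 - w, x.2) :=
  (hφ.mul (continuousOn_univ.1 (hk.comp (f := fun w : ℂ => (x.1 - w, x.2)) (by fun_prop)
    (fun _ _ => hx)))).integrable_of_hasCompactSupport hs.mul_right

lemma contDiffOn_heatExt {φ : ℂ → ℝ} (hφ : Continuous φ) (hs : HasCompactSupport φ) :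
    ContDiffOn ℝ (⊤ : ℕ∞) (heatExt φ) upper :=
  contDiffOn_kernelConv contDiffOn_heatKernel hφ hs

/-- The caloric extension solves the heat equation. -/
lemma lineDeriv_heatExt_time {φ : ℂ → ℝ} (hφ : Continuous φ) (hs : HasCompactSupport φ)
    {x : ℂ × ℝ} (hx : x ∈ upper) :
    lineDeriv ℝ (heatExt φ) x (0, 1) = spaceLaplacian (heatExt φ) x := by
  have hK := contDiffOn_heatKernel
  have hc : ∀ v, ContinuousOn (fun y => lineDeriv ℝ (fun z => lineDeriv ℝ heatKernel z v) y v)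
      upper := fun v => (contDiffOn_lineDeriv (contDiffOn_lineDeriv hK v) v).continuousOn
  rw [spaceLaplacian, heatExt, lineDeriv_kernelConv hK hφ hs hx,
    lineDeriv_lineDeriv_kernelConv hK hφ hs hx, lineDeriv_lineDeriv_kernelConv hK hφ hs hx]
  simp only [kernelConv]
  rw [← integral_add (integrable_mul_kernel (hc _) hφ hs hx)
    (integrable_mul_kernel (hc _) hφ hs hx)]
  refine integral_congr_ae (ae_of_all _ fun w => ?_)
  have := spaceLaplacian_heatKernel (x := (x.1 - w, x.2)) hx
  simp only [spaceLaplacian] at this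
  simp only [← this]
  ring

section IntegrationByParts

variable {f g : ℂ → ℝ}

lemma lineDeriv_eq_fderiv_of_contDiff (hf : ContDiff ℝ 1 f) (z e : ℂ) :
    lineDeriv ℝ f z e = fderiv ℝ f z e :=
  ((hf.differentiable (by simp)) z).lineDeriv_eq_fderiv

lemma continuous_lineDeriv_of_contDiff (hf : ContDiff ℝ 1 f) (e : ℂ) :
    Continuous fun z => lineDeriv ℝ f z e := by
  simp only [lineDeriv_eq_fderiv_of_contDiff hf]
  exact (hf.continuous_fderiv (by simp)).clm_apply continuous_const

lemma contDiff_lineDeriv_of_contDiff (hf : ContDiff ℝ (⊤ : ℕ∞) f) (e : ℂ) :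
    ContDiff ℝ (⊤ : ℕ∞) fun z => lineDeriv ℝ f z e := by
  simp only [lineDeriv_eq_fderiv_of_contDiff (hf.of_le (by simp))]
  exact (hf.fderiv_right (m := (⊤ : ℕ∞)) (by simp)).clm_apply contDiff_const

lemma hasCompactSupport_lineDeriv (hs : HasCompactSupport f) (e : ℂ) :
    HasCompactSupport fun z => lineDeriv ℝ f z e := by
  refine HasCompactSupport.intro hs fun z hz => ?_
  have : f =ᶠ[𝓝 z] fun _ => 0 := notMem_tsupport_iff_eventuallyEq.1 hz
  rw [this.lineDeriv_eq]
  simp [lineDeriv]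

/-- Integration by parts against a compactly supported function. -/
lemma integral_mul_lineDeriv (hf : ContDiff ℝ 1 f) (hs : HasCompactSupport f)
    (hg : ContDiff ℝ 1 g) (e : ℂ) :
    ∫ z, f z * lineDeriv ℝ g z e = -∫ z, lineDeriv ℝ f z e * g z := by
  have hl : ∀ {h : ℂ → ℝ}, ContDiff ℝ 1 h → ∀ z, HasLineDerivAt ℝ h (lineDeriv ℝ h z e) z e :=
    fun hh z => ((hh.differentiable (by simp)) z).lineDifferentiableAt.hasLineDerivAt
  have := integral_bilinear_hasLineDerivAt_right_eq_neg_left_of_integrable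
    (μ := (volume : Measure ℂ)) (B := ContinuousLinearMap.mul ℝ ℝ) (f := f) (g := g)
    (f' := fun z => lineDeriv ℝ f z e) (g' := fun z => lineDeriv ℝ g z e) (v := e)
    (((continuous_lineDeriv_of_contDiff hf e).mul hg.continuous).integrable_of_hasCompactSupport
      (hasCompactSupport_lineDeriv hs e).mul_right)
    ((hf.continuous.mul (continuous_lineDeriv_of_contDiff hg e)).integrable_of_hasCompactSupport
      hs.mul_right)
    ((hf.continuous.mul hg.continuous).integrable_of_hasCompactSupport hs.mul_right)
    (fun z _ => hl hf z) (fun z _ => hl hg z)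
  simpa using this

end IntegrationByParts

lemma heatKernel_pos {x : ℂ × ℝ} (hx : x ∈ upper) : 0 < heatKernel x := by
  have : 0 < x.2 := hx
  unfold heatKernel
  positivity

lemma heatKernel_le {x : ℂ × ℝ} (hx : x ∈ upper) : heatKernel x ≤ (4 * Real.pi * x.2)⁻¹ := by
  have : 0 < x.2 := hx
  refine mul_le_of_le_one_right (by positivity) (Real.exp_le_one_iff.2 ?_)
  rw [neg_div]
  exact neg_nonpos.2 (by positivity)

lemma heatKernel_eq_norm (z : ℂ) (t : ℝ) :
    heatKernel (z, t) = (4 * Real.pi * t)⁻¹ * Real.exp (-(4 * t)⁻¹ * ‖z‖ ^ 2) := by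
  simp only [heatKernel, ← normSq_eq_norm_sq, normSq_apply]
  ring_nf

lemma integral_heatKernel {t : ℝ} (ht : 0 < t) : ∫ w : ℂ, heatKernel (w, t) = 1 := by
  simp only [heatKernel_eq_norm]
  rw [integral_const_mul, GaussianFourier.integral_rexp_neg_mul_sq_norm (by positivity)]
  rw [Complex.finrank_real_complex]
  norm_num
  field_simp

lemma integrable_heatKernel {t : ℝ} (ht : 0 < t) : Integrable fun w : ℂ => heatKernel (w, t) := by
  by_contra h
  simpa [integral_undef h] using integral_heatKernel ht

lemma continuous_heatKernel_slice {t : ℝ} (ht : 0 < t) :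
    Continuous fun w : ℂ => heatKernel (w, t) :=
  continuousOn_univ.1 (contDiffOn_heatKernel.continuousOn.comp (f := fun w : ℂ => (w, t))
    (by fun_prop) (fun _ _ => ht))

lemma integral_heatKernel_sub {x : ℂ × ℝ} (hx : x ∈ upper) :
    ∫ w : ℂ, heatKernel (x.1 - w, x.2) = 1 := by
  rw [integral_sub_left_eq_self (fun w => heatKernel (w, x.2)) volume x.1, integral_heatKernel hx]

lemma integrable_heatKernel_sub {x : ℂ × ℝ} (hx : x ∈ upper) :
    Integrable fun w : ℂ => heatKernel (x.1 - w, x.2) :=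
  (integrable_heatKernel hx).comp_sub_left x.1

variable {φ ψ : ℂ → ℝ} {x : ℂ × ℝ}

lemma integrable_mul_heatKernel (hφ : Continuous φ) (hs : HasCompactSupport φ) (hx : x ∈ upper) :
    Integrable fun w => φ w * heatKernel (x.1 - w, x.2) :=
  integrable_mul_kernel contDiffOn_heatKernel.continuousOn hφ hs hx

lemma heatExt_mono (hφ : Continuous φ) (hsφ : HasCompactSupport φ) (hψ : Continuous ψ)
    (hsψ : HasCompactSupport ψ) (h : ∀ w, φ w ≤ ψ w) (hx : x ∈ upper) :
    heatExt φ x ≤ heatExt ψ x :=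
  integral_mono (integrable_mul_heatKernel hφ hsφ hx) (integrable_mul_heatKernel hψ hsψ hx)
    fun w => mul_le_mul_of_nonneg_right (h w) (heatKernel_pos (x := (x.1 - w, x.2)) hx).le

lemma heatExt_nonneg (h : ∀ w, 0 ≤ φ w) (hx : x ∈ upper) : 0 ≤ heatExt φ x :=
  integral_nonneg fun w => mul_nonneg (h w) (heatKernel_pos (x := (x.1 - w, x.2)) hx).le

lemma heatExt_pos (hφ : Continuous φ) (hs : HasCompactSupport φ) (h : ∀ w, 0 ≤ φ w)
    (h0 : ∃ w, φ w ≠ 0) (hx : x ∈ upper) : 0 < heatExt φ x := by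
  obtain ⟨w₀, hw₀⟩ := h0
  refine Continuous.integral_pos_of_hasCompactSupport_nonneg_nonzero (x := w₀) ?_ hs.mul_right
    (fun w => mul_nonneg (h w) (heatKernel_pos (x := (x.1 - w, x.2)) hx).le)
    (mul_ne_zero hw₀ (heatKernel_pos (x := (x.1 - w₀, x.2)) hx).ne')
  exact hφ.mul ((continuous_heatKernel_slice hx).comp (by fun_prop))

lemma abs_heatExt_le_heatExt_abs (hx : x ∈ upper) :
    |heatExt φ x| ≤ heatExt (fun w => |φ w|) x := by
  refine abs_integral_le_integral_abs.trans_eq (integral_congr_ae (ae_of_all _ fun w => ?_))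
  simp only [abs_mul, abs_of_pos (heatKernel_pos (x := (x.1 - w, x.2)) hx)]

lemma abs_heatExt_le_of_bound {C : ℝ} (h : ∀ w, |φ w| ≤ C) (hx : x ∈ upper) :
    |heatExt φ x| ≤ C := by
  have hi := integrable_heatKernel_sub hx
  calc |heatExt φ x| ≤ ∫ w, C * heatKernel (x.1 - w, x.2) := by
        rw [← Real.norm_eq_abs]
        refine norm_integral_le_of_norm_le (hi.const_mul C) (ae_of_all _ fun w => ?_)
        have hk := (heatKernel_pos (x := (x.1 - w, x.2)) hx).le
        rw [Real.norm_eq_abs, abs_mul, abs_of_nonneg hk]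
        exact mul_le_mul_of_nonneg_right (h w) hk
    _ = C := by rw [integral_const_mul, integral_heatKernel_sub hx, mul_one]

lemma abs_heatExt_le_integral (hφ : Continuous φ) (hs : HasCompactSupport φ) (hx : x ∈ upper) :
    |heatExt φ x| ≤ (∫ w, |φ w|) * (4 * Real.pi * x.2)⁻¹ := by
  rw [← integral_mul_const, ← Real.norm_eq_abs]
  refine norm_integral_le_of_norm_le
    ((hφ.integrable_of_hasCompactSupport hs).abs.mul_const _) (ae_of_all _ fun w => ?_)
  have hk := heatKernel_pos (x := (x.1 - w, x.2)) hx
  rw [Real.norm_eq_abs, abs_mul, abs_of_pos hk]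
  exact mul_le_mul_of_nonneg_left (heatKernel_le (x := (x.1 - w, x.2)) hx) (abs_nonneg _)

lemma rpow_add_mul_sub_le_rpow {a y s : ℝ} (ha : 0 ≤ a) (hy : 0 ≤ y) (hs : 1 ≤ s) :
    y ^ s + s * y ^ (s - 1) * (a - y) ≤ a ^ s := by
  rcases hy.eq_or_lt with rfl | hy
  · rcases hs.eq_or_lt with rfl | hs
    · simp
    · rw [Real.zero_rpow (by linarith), Real.zero_rpow (by linarith)]
      simpa using Real.rpow_nonneg ha s
  · have h := one_add_mul_self_le_rpow_one_add (s := a / y - 1)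
      (by linarith [div_nonneg ha hy.le]) hs
    rw [add_sub_cancel, Real.div_rpow ha hy.le, le_div_iff₀ (by positivity)] at h
    rw [Real.rpow_sub_one hy.ne']
    refine le_of_eq_of_le ?_ h
    field_simp

/-- Jensen's inequality for the heat semigroup. -/
lemma abs_heatExt_rpow_le (hφ : Continuous φ) (hs : HasCompactSupport φ) {s : ℝ} (h1 : 1 ≤ s)
    (hx : x ∈ upper) : |heatExt φ x| ^ s ≤ heatExt (fun w => |φ w| ^ s) x := by
  set y := heatExt (fun w => |φ w|) x with hy
  have hy0 : 0 ≤ y := heatExt_nonneg (fun w => abs_nonneg _) hx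
  have hle : |heatExt φ x| ≤ y := abs_heatExt_le_heatExt_abs hx
  have hs0 : s ≠ 0 := by linarith
  have hca : HasCompactSupport fun w => |φ w| := hs.comp_left abs_zero
  have hcs : HasCompactSupport fun w => |φ w| ^ s :=
    hs.comp_left (g := fun r => |r| ^ s) (by simp [hs0])
  have hcont : Continuous fun w => |φ w| ^ s :=
    hφ.abs.rpow_const fun _ => Or.inr (by linarith)
  refine (Real.rpow_le_rpow (abs_nonneg _) hle (by linarith)).trans ?_
  have hk := integrable_heatKernel_sub hx
  have ha := integrable_mul_heatKernel hφ.abs hca hx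
  have key : ∫ w, (y ^ s * heatKernel (x.1 - w, x.2) + s * y ^ (s - 1) *
      (|φ w| * heatKernel (x.1 - w, x.2) - y * heatKernel (x.1 - w, x.2))) ≤
      heatExt (fun w => |φ w| ^ s) x := by
    refine integral_mono ((hk.const_mul _).add ((ha.sub (hk.const_mul _)).const_mul _))
      (integrable_mul_heatKernel hcont hcs hx) fun w => ?_
    have := mul_le_mul_of_nonneg_right (rpow_add_mul_sub_le_rpow (abs_nonneg (φ w)) hy0 h1)
      (heatKernel_pos (x := (x.1 - w, x.2)) hx).le
    refine le_of_eq_of_le ?_ this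
    ring
  have hsub : Integrable fun w => s * y ^ (s - 1) *
      (|φ w| * heatKernel (x.1 - w, x.2) - y * heatKernel (x.1 - w, x.2)) :=
    (ha.sub (hk.const_mul _)).const_mul _
  rw [integral_add (hk.const_mul _) hsub, integral_const_mul,
    integral_const_mul, integral_sub ha (hk.const_mul _), integral_const_mul,
    integral_heatKernel_sub hx] at key
  change _ + _ * (y - _) ≤ _ at key
  simpa using key

lemma integrable_heatExt_slice (hφ : Continuous φ) (hs : HasCompactSupport φ) {t : ℝ}
    (ht : 0 < t) : Integrable fun z => heatExt φ (z, t) :=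
  (hφ.integrable_of_hasCompactSupport hs).integrable_convolution (ContinuousLinearMap.mul ℝ ℝ)
    (integrable_heatKernel ht)

lemma integral_heatExt_slice (hφ : Continuous φ) (hs : HasCompactSupport φ) {t : ℝ} (ht : 0 < t) :
    ∫ z, heatExt φ (z, t) = ∫ z, φ z := by
  have := integral_convolution (ContinuousLinearMap.mul ℝ ℝ) (μ := volume) (ν := volume)
    (hφ.integrable_of_hasCompactSupport hs) (integrable_heatKernel ht)
  rw [integral_heatKernel ht, ContinuousLinearMap.mul_apply', mul_one] at this
  exact this

lemma integral_abs_heatExt_slice_le (hφ : Continuous φ) (hs : HasCompactSupport φ) {t : ℝ}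
    (ht : 0 < t) : ∫ z, |heatExt φ (z, t)| ≤ ∫ z, |φ z| := by
  have hca : HasCompactSupport fun w => |φ w| := hs.comp_left abs_zero
  rw [← integral_heatExt_slice hφ.abs hca ht]
  exact integral_mono (integrable_heatExt_slice hφ hs ht).abs
    (integrable_heatExt_slice hφ.abs hca ht) fun z => abs_heatExt_le_heatExt_abs (x := (z, t)) ht

lemma contDiff_heatExt_slice (hφ : Continuous φ) (hs : HasCompactSupport φ) {t : ℝ} (ht : 0 < t) :
    ContDiff ℝ (⊤ : ℕ∞) fun z => heatExt φ (z, t) :=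
  contDiffOn_univ.1 ((contDiffOn_heatExt hφ hs).comp (f := fun z : ℂ => (z, t))
    (ContDiff.contDiffOn (by fun_prop)) (fun _ _ => ht))

/-- Spatial derivatives commute with the heat flow. -/
lemma lineDeriv_heatExt (hφ : ContDiff ℝ 1 φ) (hs : HasCompactSupport φ) (e : ℂ)
    (hx : x ∈ upper) :
    lineDeriv ℝ (heatExt φ) x (e, 0) = heatExt (fun w => lineDeriv ℝ φ w e) x := by
  have hk : ContDiff ℝ 1 fun w : ℂ => heatKernel (x.1 - w, x.2) :=
    contDiffOn_univ.1 ((contDiffOn_heatKernel.of_le (by simp)).comp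
      (f := fun w : ℂ => (x.1 - w, x.2)) (ContDiff.contDiffOn (by fun_prop)) (fun _ _ => hx))
  have hp := integral_mul_lineDeriv hφ hs hk e
  rw [heatExt, lineDeriv_kernelConv contDiffOn_heatKernel hφ.continuous hs hx, heatExt,
    kernelConv, kernelConv, ← neg_neg (∫ w, lineDeriv ℝ φ w e * _), ← hp, ← integral_neg]
  refine integral_congr_ae (ae_of_all _ fun w => ?_)
  have : lineDeriv ℝ (fun w : ℂ => heatKernel (x.1 - w, x.2)) w e =
      -lineDeriv ℝ heatKernel (x.1 - w, x.2) (e, 0) := by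
    rw [← lineDeriv_neg]
    simp only [lineDeriv]
    congr 1
    ext s
    simp [sub_eq_add_neg, add_assoc, add_comm]
  simp [this]

/-- The heat flow is continuous at time zero. -/
lemma tendsto_heatExt_zero (hφ : Continuous φ) (hs : HasCompactSupport φ) (z : ℂ) :
    Tendsto (fun t => heatExt φ (z, t)) (𝓝[>] 0) (𝓝 (φ z)) := by
  have h0 : Tendsto (fun w : ℂ => ‖w‖ ^ Module.finrank ℝ ℂ * heatKernel (w, 1))
      (Bornology.cobounded ℂ) (𝓝 0) := by
    have h1 : Tendsto (fun r : ℝ => (4 * (4 * Real.pi * 1)⁻¹) * (r ^ 1 * Real.exp (-r))) atTop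
        (𝓝 0) := by
      simpa using (Real.tendsto_pow_mul_exp_neg_atTop_nhds_zero 1).const_mul
        (4 * (4 * Real.pi * 1)⁻¹)
    have h2 : Tendsto (fun w : ℂ => (4 : ℝ)⁻¹ * ‖w‖ ^ 2) (Bornology.cobounded ℂ) atTop :=
      ((tendsto_pow_atTop two_ne_zero).comp tendsto_norm_cobounded_atTop).const_mul_atTop
        (by norm_num)
    refine (h1.comp h2).congr fun w => ?_
    simp only [Function.comp_apply, heatKernel_eq_norm, Complex.finrank_real_complex]
    ring_nf
  have hc := tendsto_integral_comp_smul_smul_of_integrable' (μ := (volume : Measure ℂ))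
    (φ := fun w : ℂ => heatKernel (w, 1))
    (fun w => (heatKernel_pos (x := (w, 1)) (one_pos (α := ℝ))).le) (integral_heatKernel one_pos) h0
    (hφ.integrable_of_hasCompactSupport hs) (hφ.continuousAt (x := z))
  have hr : Tendsto (fun t : ℝ => (Real.sqrt t)⁻¹) (𝓝[>] 0) atTop := by
    refine tendsto_inv_nhdsGT_zero.comp (tendsto_nhdsWithin_iff.2 ⟨?_, ?_⟩)
    · simpa using (Real.continuous_sqrt.tendsto 0).mono_left nhdsWithin_le_nhds
    · filter_upwards [self_mem_nhdsWithin] with t ht using Real.sqrt_pos.2 ht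
  refine (hc.comp hr).congr' ?_
  filter_upwards [self_mem_nhdsWithin] with t (ht : 0 < t)
  refine integral_congr_ae (ae_of_all _ fun w => ?_)
  simp only [heatKernel_eq_norm, Complex.finrank_real_complex, norm_smul, smul_eq_mul, norm_inv,
    Real.norm_eq_abs, abs_of_nonneg (Real.sqrt_nonneg t), mul_pow, inv_pow, Real.sq_sqrt ht.le]
  have : -(4 * 1)⁻¹ * (t⁻¹ * ‖z - w‖ ^ 2) = -(4 * t)⁻¹ * ‖z - w‖ ^ 2 := by
    field_simp
  rw [this]
  field_simp

/-- The backward-signed heat operator `Δ - ∂ₜ`. -/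
noncomputable def heatOp (f : ℂ × ℝ → ℝ) (x : ℂ × ℝ) : ℝ :=
  spaceLaplacian f x - lineDeriv ℝ f x (0, 1)

section Algebra

variable {f g : ℂ × ℝ → ℝ} {x : ℂ × ℝ}

lemma lineDeriv_add_of_contDiffOn (hf : ContDiffOn ℝ (⊤ : ℕ∞) f upper)
    (hg : ContDiffOn ℝ (⊤ : ℕ∞) g upper) (hx : x ∈ upper) (v : ℂ × ℝ) :
    lineDeriv ℝ (fun y => f y + g y) x v = lineDeriv ℝ f x v + lineDeriv ℝ g x v :=
  (HasDerivAt.add (hasLineDerivAt_of_contDiffOn hf hx v)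
    (hasLineDerivAt_of_contDiffOn hg hx v)).deriv

lemma lineDeriv_const_mul_of_contDiffOn (c : ℝ) (hf : ContDiffOn ℝ (⊤ : ℕ∞) f upper)
    (hx : x ∈ upper) (v : ℂ × ℝ) :
    lineDeriv ℝ (fun y => c * f y) x v = c * lineDeriv ℝ f x v :=
  (HasDerivAt.const_mul c (hasLineDerivAt_of_contDiffOn hf hx v)).deriv

lemma lineDeriv_congr_upper (h : EqOn f g upper) (hx : x ∈ upper) (v : ℂ × ℝ) :
    lineDeriv ℝ f x v = lineDeriv ℝ g x v :=
  (h.eventuallyEq_of_mem (isOpen_upper.mem_nhds hx)).lineDeriv_eq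

lemma heatOp_add (hf : ContDiffOn ℝ (⊤ : ℕ∞) f upper) (hg : ContDiffOn ℝ (⊤ : ℕ∞) g upper)
    (hx : x ∈ upper) : heatOp (fun y => f y + g y) x = heatOp f x + heatOp g x := by
  have h : ∀ v, lineDeriv ℝ (fun y => lineDeriv ℝ (fun y => f y + g y) y v) x v =
      lineDeriv ℝ (fun y => lineDeriv ℝ f y v) x v +
        lineDeriv ℝ (fun y => lineDeriv ℝ g y v) x v := fun v => by
    rw [lineDeriv_congr_upper (fun y hy => lineDeriv_add_of_contDiffOn hf hg hy v) hx,
      lineDeriv_add_of_contDiffOn (contDiffOn_lineDeriv hf v) (contDiffOn_lineDeriv hg v) hx]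
  simp only [heatOp, spaceLaplacian, h, lineDeriv_add_of_contDiffOn hf hg hx]
  ring

lemma heatOp_const_mul (c : ℝ) (hf : ContDiffOn ℝ (⊤ : ℕ∞) f upper) (hx : x ∈ upper) :
    heatOp (fun y => c * f y) x = c * heatOp f x := by
  have h : ∀ v, lineDeriv ℝ (fun y => lineDeriv ℝ (fun y => c * f y) y v) x v =
      c * lineDeriv ℝ (fun y => lineDeriv ℝ f y v) x v := fun v => by
    rw [lineDeriv_congr_upper (fun y hy => lineDeriv_const_mul_of_contDiffOn c hf hy v) hx,
      lineDeriv_const_mul_of_contDiffOn c (contDiffOn_lineDeriv hf v) hx]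
  simp only [heatOp, spaceLaplacian, h, lineDeriv_const_mul_of_contDiffOn c hf hx]
  ring

end Algebra

section Weighted

variable {F W : ℂ × ℝ → ℝ} {x : ℂ × ℝ} (β : ℝ)

lemma contDiffOn_sq_mul_rpow (hF : ContDiffOn ℝ (⊤ : ℕ∞) F upper)
    (hW : ContDiffOn ℝ (⊤ : ℕ∞) W upper) (hW0 : ∀ y ∈ upper, 0 < W y) :
    ContDiffOn ℝ (⊤ : ℕ∞) (fun y => F y ^ 2 * W y ^ β) upper :=
  (hF.pow 2).mul (hW.rpow_const_of_ne fun y hy => (hW0 y hy).ne')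

lemma lineDeriv_sq_mul_rpow (hF : ContDiffOn ℝ (⊤ : ℕ∞) F upper)
    (hW : ContDiffOn ℝ (⊤ : ℕ∞) W upper) (hW0 : ∀ y ∈ upper, 0 < W y) (hx : x ∈ upper)
    (v : ℂ × ℝ) :
    lineDeriv ℝ (fun y => F y ^ 2 * W y ^ β) x v =
      2 * F x * lineDeriv ℝ F x v * W x ^ β +
        β * F x ^ 2 * W x ^ (β - 1) * lineDeriv ℝ W x v := by
  have h1 : HasDerivAt (fun s : ℝ => F (x + s • v)) (lineDeriv ℝ F x v) 0 :=
    hasLineDerivAt_of_contDiffOn hF hx v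
  have h2 : HasDerivAt (fun s : ℝ => W (x + s • v)) (lineDeriv ℝ W x v) 0 :=
    hasLineDerivAt_of_contDiffOn hW hx v
  have h3 := (h1.pow 2).mul (h2.rpow_const (p := β) (Or.inl (by simpa using (hW0 x hx).ne')))
  refine h3.deriv.trans ?_
  simp
  ring

lemma lineDeriv_lineDeriv_sq_mul_rpow (hF : ContDiffOn ℝ (⊤ : ℕ∞) F upper)
    (hW : ContDiffOn ℝ (⊤ : ℕ∞) W upper) (hW0 : ∀ y ∈ upper, 0 < W y) (hx : x ∈ upper)
    (v : ℂ × ℝ) :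
    lineDeriv ℝ (fun y => lineDeriv ℝ (fun y => F y ^ 2 * W y ^ β) y v) x v =
      2 * lineDeriv ℝ F x v ^ 2 * W x ^ β +
        2 * F x * lineDeriv ℝ (fun y => lineDeriv ℝ F y v) x v * W x ^ β +
        4 * β * F x * lineDeriv ℝ F x v * W x ^ (β - 1) * lineDeriv ℝ W x v +
        β * (β - 1) * F x ^ 2 * W x ^ (β - 1 - 1) * lineDeriv ℝ W x v ^ 2 +
        β * F x ^ 2 * W x ^ (β - 1) * lineDeriv ℝ (fun y => lineDeriv ℝ W y v) x v := by
  rw [lineDeriv_congr_upper (fun y hy => lineDeriv_sq_mul_rpow β hF hW hW0 hy v) hx]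
  have h1 : HasDerivAt (fun s : ℝ => F (x + s • v)) (lineDeriv ℝ F x v) 0 :=
    hasLineDerivAt_of_contDiffOn hF hx v
  have h2 : HasDerivAt (fun s : ℝ => W (x + s • v)) (lineDeriv ℝ W x v) 0 :=
    hasLineDerivAt_of_contDiffOn hW hx v
  have h1' : HasDerivAt (fun s : ℝ => lineDeriv ℝ F (x + s • v) v)
      (lineDeriv ℝ (fun y => lineDeriv ℝ F y v) x v) 0 :=
    hasLineDerivAt_of_contDiffOn (contDiffOn_lineDeriv hF v) hx v
  have h2' : HasDerivAt (fun s : ℝ => lineDeriv ℝ W (x + s • v) v)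
      (lineDeriv ℝ (fun y => lineDeriv ℝ W y v) x v) 0 :=
    hasLineDerivAt_of_contDiffOn (contDiffOn_lineDeriv hW v) hx v
  have hne : W (x + (0 : ℝ) • v) ≠ 0 := by simpa using (hW0 x hx).ne'
  have h3 := (((h1.const_mul 2).mul h1').mul (h2.rpow_const (p := β) (Or.inl hne))).add
    ((((h1.pow 2).const_mul β).mul (h2.rpow_const (p := β - 1) (Or.inl hne))).mul h2')
  refine h3.deriv.trans ?_
  simp
  ring

/-- The heat operator applied to `F² W ^ β` for caloric functions `F` and `W`. -/
lemma heatOp_sq_mul_rpow (hF : ContDiffOn ℝ (⊤ : ℕ∞) F upper)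
    (hW : ContDiffOn ℝ (⊤ : ℕ∞) W upper) (hW0 : ∀ y ∈ upper, 0 < W y) (hx : x ∈ upper)
    (hFx : lineDeriv ℝ F x (0, 1) = spaceLaplacian F x)
    (hWx : lineDeriv ℝ W x (0, 1) = spaceLaplacian W x) :
    heatOp (fun y => F y ^ 2 * W y ^ β) x =
      (2 * lineDeriv ℝ F x (1, 0) ^ 2 * W x ^ β +
        4 * β * F x * lineDeriv ℝ F x (1, 0) * W x ^ (β - 1) * lineDeriv ℝ W x (1, 0) +
        β * (β - 1) * F x ^ 2 * W x ^ (β - 1 - 1) * lineDeriv ℝ W x (1, 0) ^ 2) +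
      (2 * lineDeriv ℝ F x (I, 0) ^ 2 * W x ^ β +
        4 * β * F x * lineDeriv ℝ F x (I, 0) * W x ^ (β - 1) * lineDeriv ℝ W x (I, 0) +
        β * (β - 1) * F x ^ 2 * W x ^ (β - 1 - 1) * lineDeriv ℝ W x (I, 0) ^ 2) := by
  rw [heatOp, spaceLaplacian, lineDeriv_lineDeriv_sq_mul_rpow β hF hW hW0 hx,
    lineDeriv_lineDeriv_sq_mul_rpow β hF hW hW0 hx, lineDeriv_sq_mul_rpow β hF hW hW0 hx, hFx, hWx,
    spaceLaplacian, spaceLaplacian]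
  ring

lemma weighted_quadratic_lower_bound {β r F X w d : ℝ} (hw : 0 < w) (hF : F ^ 2 ≤ w ^ (r - β)) :
    X ^ 2 * w ^ β - (3 * β ^ 2 + |β|) * (w ^ (r - 2) * d ^ 2) ≤
      2 * X ^ 2 * w ^ β + 4 * β * F * X * w ^ (β - 1) * d +
        β * (β - 1) * F ^ 2 * w ^ (β - 1 - 1) * d ^ 2 := by
  have e1 : w ^ (β - 1) = w ^ β / w := Real.rpow_sub_one hw.ne' β
  have e2 : w ^ (β - 1 - 1) = w ^ β / w / w := by rw [Real.rpow_sub_one hw.ne', e1]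
  have e3 : w ^ (r - 2) = w ^ (r - β) * (w ^ β / w / w) := by
    rw [← e2, ← Real.rpow_add hw]
    congr 1
    ring
  have hwβ : 0 < w ^ β := Real.rpow_pos_of_pos hw β
  have h1 : F ^ 2 * (w ^ β / w / w * d ^ 2) ≤ w ^ (r - 2) * d ^ 2 := by
    rw [e3, mul_assoc]
    exact mul_le_mul_of_nonneg_right hF (by positivity)
  have h2 : (3 * β ^ 2 + β) * (F ^ 2 * (w ^ β / w / w * d ^ 2)) ≤
      (3 * β ^ 2 + |β|) * (w ^ (r - 2) * d ^ 2) :=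
    mul_le_mul (by linarith [le_abs_self β]) h1 (by positivity)
      (by positivity)
  have h3 : 0 ≤ w ^ β * (X + 2 * β * (F * d / w)) ^ 2 := by positivity
  rw [e1, e2]
  have h4 : 2 * X ^ 2 * w ^ β + 4 * β * F * X * (w ^ β / w) * d +
      β * (β - 1) * F ^ 2 * (w ^ β / w / w) * d ^ 2 = X ^ 2 * w ^ β +
      w ^ β * (X + 2 * β * (F * d / w)) ^ 2 -
        (3 * β ^ 2 + β) * (F ^ 2 * (w ^ β / w / w * d ^ 2)) := by
    field_simp
    ring
  linarith

lemma le_heatOp_sq_mul_rpow {r : ℝ} (hF : ContDiffOn ℝ (⊤ : ℕ∞) F upper)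
    (hW : ContDiffOn ℝ (⊤ : ℕ∞) W upper) (hW0 : ∀ y ∈ upper, 0 < W y) (hx : x ∈ upper)
    (hFx : lineDeriv ℝ F x (0, 1) = spaceLaplacian F x)
    (hWx : lineDeriv ℝ W x (0, 1) = spaceLaplacian W x) (hFW : F x ^ 2 ≤ W x ^ (r - β)) :
    (lineDeriv ℝ F x (1, 0) ^ 2 + lineDeriv ℝ F x (I, 0) ^ 2) * W x ^ β -
      (3 * β ^ 2 + |β|) * (W x ^ (r - 2) *
        (lineDeriv ℝ W x (1, 0) ^ 2 + lineDeriv ℝ W x (I, 0) ^ 2)) ≤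
      heatOp (fun y => F y ^ 2 * W y ^ β) x := by
  rw [heatOp_sq_mul_rpow β hF hW hW0 hx hFx hWx]
  have h1 := weighted_quadratic_lower_bound (X := lineDeriv ℝ F x (1, 0))
    (d := lineDeriv ℝ W x (1, 0)) (hW0 x hx) hFW
  have h2 := weighted_quadratic_lower_bound (X := lineDeriv ℝ F x (I, 0))
    (d := lineDeriv ℝ W x (I, 0)) (hW0 x hx) hFW
  linarith

lemma heatOp_rpow (r : ℝ) (hW : ContDiffOn ℝ (⊤ : ℕ∞) W upper) (hW0 : ∀ y ∈ upper, 0 < W y)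
    (hx : x ∈ upper) (hWx : lineDeriv ℝ W x (0, 1) = spaceLaplacian W x) :
    heatOp (fun y => W y ^ r) x = r * (r - 1) * (W x ^ (r - 2) *
      (lineDeriv ℝ W x (1, 0) ^ 2 + lineDeriv ℝ W x (I, 0) ^ 2)) := by
  have hc : ∀ y v, lineDeriv ℝ (fun _ : ℂ × ℝ => (1 : ℝ)) y v = 0 := fun y v => by
    simp [lineDeriv]
  have h := heatOp_sq_mul_rpow (F := fun _ => 1) r contDiffOn_const hW hW0 hx
    (by simp [spaceLaplacian, lineDeriv]) hWx
  simp only [one_pow, one_mul, hc] at h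
  rw [h]
  ring_nf

end Weighted

/-- The Bellman function of the bilinear embedding, evaluated along caloric functions. -/
noncomputable def bellman (r β : ℝ) (W F₁ F₂ G : ℂ × ℝ → ℝ) (x : ℂ × ℝ) : ℝ :=
  3 * (3 * β ^ 2 + |β|) / (r * (r - 1)) * W x ^ r + F₁ x ^ 2 * W x ^ β + F₂ x ^ 2 * W x ^ β +
    G x ^ 2 * W x ^ (-β)

section Bellman

variable {r β : ℝ} {W F₁ F₂ G : ℂ × ℝ → ℝ}

lemma contDiffOn_bellman (hW : ContDiffOn ℝ (⊤ : ℕ∞) W upper) (hW0 : ∀ y ∈ upper, 0 < W y)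
    (hF₁ : ContDiffOn ℝ (⊤ : ℕ∞) F₁ upper) (hF₂ : ContDiffOn ℝ (⊤ : ℕ∞) F₂ upper)
    (hG : ContDiffOn ℝ (⊤ : ℕ∞) G upper) :
    ContDiffOn ℝ (⊤ : ℕ∞) (bellman r β W F₁ F₂ G) upper :=
  (((contDiffOn_const.mul (hW.rpow_const_of_ne fun y hy => (hW0 y hy).ne')).add
    (contDiffOn_sq_mul_rpow β hF₁ hW hW0)).add (contDiffOn_sq_mul_rpow β hF₂ hW hW0)).add
    (contDiffOn_sq_mul_rpow (-β) hG hW hW0)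

lemma bellman_nonneg (hr : 1 < r) {x : ℂ × ℝ} (hW0 : 0 < W x) : 0 ≤ bellman r β W F₁ F₂ G x := by
  have : 0 < r - 1 := by linarith
  unfold bellman
  positivity

lemma bellman_le {x : ℂ × ℝ} (hW0 : 0 < W x) (h₁ : F₁ x ^ 2 ≤ W x ^ (r - β))
    (h₂ : F₂ x ^ 2 ≤ W x ^ (r - β)) (hG : G x ^ 2 ≤ W x ^ (r + β)) :
    bellman r β W F₁ F₂ G x ≤ (3 * (3 * β ^ 2 + |β|) / (r * (r - 1)) + 3) * W x ^ r := by
  have e1 : W x ^ r = W x ^ (r - β) * W x ^ β := by rw [← Real.rpow_add hW0]; ring_nf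
  have e2 : W x ^ r = W x ^ (r + β) * W x ^ (-β) := by rw [← Real.rpow_add hW0]; ring_nf
  have i1 := mul_le_mul_of_nonneg_right h₁ (Real.rpow_pos_of_pos hW0 β).le
  have i2 := mul_le_mul_of_nonneg_right h₂ (Real.rpow_pos_of_pos hW0 β).le
  have i3 := mul_le_mul_of_nonneg_right hG (Real.rpow_pos_of_pos hW0 (-β)).le
  rw [← e1] at i1 i2
  rw [← e2] at i3
  unfold bellman
  linarith

lemma abs_add_mul_le_of_mul_eq_one {m m' : ℝ} (hm : 0 < m) (hm' : 0 < m') (hmm : m * m' = 1)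
    (a b c : ℝ) : |(a + b) * c| ≤ a ^ 2 * m + b ^ 2 * m + c ^ 2 * m' := by
  have q1 : 0 ≤ m' * (m * (a + b) - c) ^ 2 := by positivity
  have q2 : 0 ≤ m' * (m * (a + b) + c) ^ 2 := by positivity
  have q3 : 0 ≤ m * (a - b) ^ 2 := by positivity
  have q4 : 0 ≤ c ^ 2 * m' := by positivity
  have e1 : m' * (m * (a + b) - c) ^ 2 =
      m * (a + b) ^ 2 - 2 * ((a + b) * c) + c ^ 2 * m' := by
    linear_combination (m * (a + b) ^ 2 - 2 * ((a + b) * c)) * hmm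
  have e2 : m' * (m * (a + b) + c) ^ 2 =
      m * (a + b) ^ 2 + 2 * ((a + b) * c) + c ^ 2 * m' := by
    linear_combination (m * (a + b) ^ 2 + 2 * ((a + b) * c)) * hmm
  have e3 : m * (a + b) ^ 2 = 2 * (a ^ 2 * m) + 2 * (b ^ 2 * m) - m * (a - b) ^ 2 := by ring
  rw [abs_le]
  constructor <;> linarith

/-- The Bellman function dominates the bilinear gradient expression. -/
lemma abs_mul_le_heatOp_bellman (hr : 1 < r)
    (hW : ContDiffOn ℝ (⊤ : ℕ∞) W upper) (hW0 : ∀ y ∈ upper, 0 < W y)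
    (hF₁ : ContDiffOn ℝ (⊤ : ℕ∞) F₁ upper) (hF₂ : ContDiffOn ℝ (⊤ : ℕ∞) F₂ upper)
    (hG : ContDiffOn ℝ (⊤ : ℕ∞) G upper) {x : ℂ × ℝ} (hx : x ∈ upper)
    (hWx : lineDeriv ℝ W x (0, 1) = spaceLaplacian W x)
    (hF₁x : lineDeriv ℝ F₁ x (0, 1) = spaceLaplacian F₁ x)
    (hF₂x : lineDeriv ℝ F₂ x (0, 1) = spaceLaplacian F₂ x)
    (hGx : lineDeriv ℝ G x (0, 1) = spaceLaplacian G x)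
    (h₁ : F₁ x ^ 2 ≤ W x ^ (r - β)) (h₂ : F₂ x ^ 2 ≤ W x ^ (r - β))
    (h₃ : G x ^ 2 ≤ W x ^ (r + β)) {e : ℂ} (he : e = 1 ∨ e = I) :
    |(lineDeriv ℝ F₁ x (1, 0) + lineDeriv ℝ F₂ x (I, 0)) * lineDeriv ℝ G x (e, 0)| ≤
      heatOp (bellman r β W F₁ F₂ G) x := by
  have hWr : ContDiffOn ℝ (⊤ : ℕ∞) (fun y => W y ^ r) upper :=
    hW.rpow_const_of_ne fun y hy => (hW0 y hy).ne'
  have s0 := contDiffOn_const (c := 3 * (3 * β ^ 2 + |β|) / (r * (r - 1))) (s := upper)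
    (𝕜 := ℝ) (n := (⊤ : ℕ∞)) |>.mul hWr
  have s1 := contDiffOn_sq_mul_rpow β hF₁ hW hW0
  have s2 := contDiffOn_sq_mul_rpow β hF₂ hW hW0
  have s3 := contDiffOn_sq_mul_rpow (-β) hG hW hW0
  have hsum : heatOp (bellman r β W F₁ F₂ G) x =
      3 * (3 * β ^ 2 + |β|) / (r * (r - 1)) * heatOp (fun y => W y ^ r) x +
      heatOp (fun y => F₁ y ^ 2 * W y ^ β) x + heatOp (fun y => F₂ y ^ 2 * W y ^ β) x +
      heatOp (fun y => G y ^ 2 * W y ^ (-β)) x := by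
    unfold bellman
    rw [heatOp_add ((s0.add s1).add s2) s3 hx, heatOp_add (s0.add s1) s2 hx, heatOp_add s0 s1 hx,
      heatOp_const_mul _ hWr hx]
  have hr0 : r * (r - 1) ≠ 0 := mul_ne_zero (by linarith) (by linarith)
  have k0 := heatOp_rpow r hW hW0 hx hWx
  have k1 := le_heatOp_sq_mul_rpow β hF₁ hW hW0 hx hF₁x hWx h₁
  have k2 := le_heatOp_sq_mul_rpow β hF₂ hW hW0 hx hF₂x hWx h₂
  have k3 := le_heatOp_sq_mul_rpow (-β) hG hW hW0 hx hGx hWx (by rwa [sub_neg_eq_add])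
  rw [neg_sq, abs_neg] at k3
  rw [k0, ← mul_assoc, div_mul_cancel₀ _ hr0] at hsum
  set a := lineDeriv ℝ F₁ x (1, 0)
  set b := lineDeriv ℝ F₂ x (I, 0)
  set c := lineDeriv ℝ G x (e, 0)
  have hc : c ^ 2 ≤ lineDeriv ℝ G x (1, 0) ^ 2 + lineDeriv ℝ G x (I, 0) ^ 2 := by
    rcases he with rfl | rfl
    · exact le_add_of_nonneg_right (sq_nonneg _)
    · exact le_add_of_nonneg_left (sq_nonneg _)
  set m := W x ^ β with hm
  set m' := W x ^ (-β) with hm'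
  have hm0 : 0 < m := Real.rpow_pos_of_pos (hW0 x hx) β
  have hm0' : 0 < m' := Real.rpow_pos_of_pos (hW0 x hx) (-β)
  have hmm : m * m' = 1 := by
    rw [hm, hm', ← Real.rpow_add (hW0 x hx), add_neg_cancel, Real.rpow_zero]
  have c1 : a ^ 2 * m ≤ (a ^ 2 + lineDeriv ℝ F₁ x (I, 0) ^ 2) * m :=
    mul_le_mul_of_nonneg_right (le_add_of_nonneg_right (sq_nonneg _)) hm0.le
  have c2 : b ^ 2 * m ≤ (lineDeriv ℝ F₂ x (1, 0) ^ 2 + b ^ 2) * m :=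
    mul_le_mul_of_nonneg_right (le_add_of_nonneg_left (sq_nonneg _)) hm0.le
  have c3 := mul_le_mul_of_nonneg_right hc hm0'.le
  have hmain : |(a + b) * c| ≤ a ^ 2 * m + b ^ 2 * m + c ^ 2 * m' :=
    abs_add_mul_le_of_mul_eq_one hm0 hm0' hmm a b c
  linarith

end Bellman

/-- The Laplacian on the plane. -/
noncomputable def planeLaplacian (f : ℂ → ℝ) (z : ℂ) : ℝ :=
  lineDeriv ℝ (fun y => lineDeriv ℝ f y 1) z 1 + lineDeriv ℝ (fun y => lineDeriv ℝ f y I) z I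

section Plane

variable {f g χ h D : ℂ → ℝ}

lemma lineDeriv_mul_of_contDiff (hf : ContDiff ℝ 1 f) (hg : ContDiff ℝ 1 g) (z e : ℂ) :
    lineDeriv ℝ (fun y => f y * g y) z e = lineDeriv ℝ f z e * g z + f z * lineDeriv ℝ g z e := by
  rw [lineDeriv_eq_fderiv_of_contDiff (hf.mul hg), lineDeriv_eq_fderiv_of_contDiff hf,
    lineDeriv_eq_fderiv_of_contDiff hg, fderiv_fun_mul (hf.differentiable (by simp) z)
    (hg.differentiable (by simp) z)]
  simp
  ring

lemma continuous_planeLaplacian (hf : ContDiff ℝ (⊤ : ℕ∞) f) : Continuous (planeLaplacian f) :=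
  (contDiff_lineDeriv_of_contDiff (contDiff_lineDeriv_of_contDiff hf 1) 1).continuous.add
    (contDiff_lineDeriv_of_contDiff (contDiff_lineDeriv_of_contDiff hf I) I).continuous

lemma hasCompactSupport_planeLaplacian (hs : HasCompactSupport f) :
    HasCompactSupport (planeLaplacian f) :=
  (hasCompactSupport_lineDeriv (hasCompactSupport_lineDeriv hs 1) 1).add
    (hasCompactSupport_lineDeriv (hasCompactSupport_lineDeriv hs I) I)

lemma planeLaplacian_mul (hf : ContDiff ℝ (⊤ : ℕ∞) f) (hg : ContDiff ℝ (⊤ : ℕ∞) g) (z : ℂ) :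
    planeLaplacian (fun y => f y * g y) z = planeLaplacian f z * g z + f z * planeLaplacian g z +
      2 * (lineDeriv ℝ f z 1 * lineDeriv ℝ g z 1 + lineDeriv ℝ f z I * lineDeriv ℝ g z I) := by
  have h1 : ∀ {k : ℂ → ℝ}, ContDiff ℝ (⊤ : ℕ∞) k → ContDiff ℝ 1 k := fun hk => hk.of_le (by simp)
  have key : ∀ e, lineDeriv ℝ (fun y => lineDeriv ℝ (fun y => f y * g y) y e) z e =
      lineDeriv ℝ (fun y => lineDeriv ℝ f y e) z e * g z +
      f z * lineDeriv ℝ (fun y => lineDeriv ℝ g y e) z e +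
      2 * (lineDeriv ℝ f z e * lineDeriv ℝ g z e) := fun e => by
    have hf' := h1 (contDiff_lineDeriv_of_contDiff hf e)
    have hg' := h1 (contDiff_lineDeriv_of_contDiff hg e)
    have e1 : (fun y => lineDeriv ℝ (fun y => f y * g y) y e) =
        fun y => lineDeriv ℝ f y e * g y + f y * lineDeriv ℝ g y e :=
      funext fun y => lineDeriv_mul_of_contDiff (h1 hf) (h1 hg) y e
    have hp1 := hf'.mul (h1 hg)
    have hp2 := (h1 hf).mul hg'
    rw [e1, lineDeriv_eq_fderiv_of_contDiff (hp1.add hp2),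
      fderiv_fun_add (hp1.differentiable (by simp) z) (hp2.differentiable (by simp) z)]
    rw [add_apply, ← lineDeriv_eq_fderiv_of_contDiff hp1,
      ← lineDeriv_eq_fderiv_of_contDiff hp2, lineDeriv_mul_of_contDiff hf' (h1 hg),
      lineDeriv_mul_of_contDiff (h1 hf) hg']
    ring
  simp only [planeLaplacian, key]
  ring

lemma integral_mul_planeLaplacian (hχ : ContDiff ℝ (⊤ : ℕ∞) χ) (hs : HasCompactSupport χ)
    (hf : ContDiff ℝ (⊤ : ℕ∞) f) :
    ∫ z, χ z * planeLaplacian f z = ∫ z, planeLaplacian χ z * f z := by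
  have h1 : ∀ {k : ℂ → ℝ}, ContDiff ℝ (⊤ : ℕ∞) k → ContDiff ℝ 1 k := fun hk => hk.of_le (by simp)
  have key : ∀ e, ∫ z, χ z * lineDeriv ℝ (fun y => lineDeriv ℝ f y e) z e =
      ∫ z, lineDeriv ℝ (fun y => lineDeriv ℝ χ y e) z e * f z := fun e => by
    rw [integral_mul_lineDeriv (h1 hχ) hs (h1 (contDiff_lineDeriv_of_contDiff hf e)),
      integral_mul_lineDeriv (h1 (contDiff_lineDeriv_of_contDiff hχ e))
        (hasCompactSupport_lineDeriv hs e) (h1 hf), neg_neg]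
  have i1 : ∀ e, Integrable fun z => χ z * lineDeriv ℝ (fun y => lineDeriv ℝ f y e) z e :=
    fun e => (hχ.continuous.mul (contDiff_lineDeriv_of_contDiff
      (contDiff_lineDeriv_of_contDiff hf e) e).continuous).integrable_of_hasCompactSupport
      hs.mul_right
  have i2 : ∀ e, Integrable fun z => lineDeriv ℝ (fun y => lineDeriv ℝ χ y e) z e * f z :=
    fun e => ((contDiff_lineDeriv_of_contDiff (contDiff_lineDeriv_of_contDiff hχ e)
      e).continuous.mul hf.continuous).integrable_of_hasCompactSupport
      (hasCompactSupport_lineDeriv (hasCompactSupport_lineDeriv hs e) e).mul_right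
  simp only [planeLaplacian, mul_add, add_mul]
  rw [integral_add (i1 1) (i1 I), integral_add (i2 1) (i2 I), key, key]

/-- Integration by parts against a slowly varying cutoff `χ`. -/
lemma neg_integral_cutoff_le {e : ℂ} {κ M N : ℝ} (hχ : ContDiff ℝ (⊤ : ℕ∞) χ)
    (hs : HasCompactSupport χ) (hh : ContDiff ℝ (⊤ : ℕ∞) h) (hg : ContDiff ℝ (⊤ : ℕ∞) g)
    (hD : ContDiff ℝ (⊤ : ℕ∞) D) (hhD : ∀ z, planeLaplacian h z = lineDeriv ℝ D z e)
    (hgi : Integrable g) (hgN : ∫ z, |g z| ≤ N) (hκ : 0 ≤ κ) (hM : 0 ≤ M)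
    (hχe : ∀ z, |lineDeriv ℝ χ z e| ≤ κ) (hχ1 : ∀ z, |lineDeriv ℝ χ z 1| ≤ κ)
    (hχI : ∀ z, |lineDeriv ℝ χ z I| ≤ κ) (hχΔ : ∀ z, |planeLaplacian χ z| ≤ κ)
    (hDM : ∀ z, |D z| ≤ M) (hhM : ∀ z, |h z| ≤ M) (hh1 : ∀ z, |lineDeriv ℝ h z 1| ≤ M)
    (hhI : ∀ z, |lineDeriv ℝ h z I| ≤ M) :
    -∫ z, χ z * (lineDeriv ℝ D z e * g z + h z * planeLaplacian g z) ≤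
      2 * (∫ z, χ z * (D z * lineDeriv ℝ g z e)) + 7 * κ * M * N := by
  have h1 : ∀ {k : ℂ → ℝ}, ContDiff ℝ (⊤ : ℕ∞) k → ContDiff ℝ 1 k := fun hk => hk.of_le (by simp)
  have cl : ∀ {k : ℂ → ℝ} (a), ContDiff ℝ (⊤ : ℕ∞) k → Continuous fun z => lineDeriv ℝ k z a :=
    fun a hk => (contDiff_lineDeriv_of_contDiff hk a).continuous
  have hχc := hχ.continuous
  have hhc := hh.continuous
  have hgc := hg.continuous
  have hDc := hD.continuous
  have cge := cl e hg
  have cDe := cl e hD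
  have cχe := cl e hχ
  have cχ1 := cl 1 hχ
  have cχI := cl I hχ
  have ch1 := cl 1 hh
  have chI := cl I hh
  have cgΔ := continuous_planeLaplacian hg
  have cχΔ := continuous_planeLaplacian hχ
  have se := hasCompactSupport_lineDeriv hs e
  have s1 := hasCompactSupport_lineDeriv hs 1
  have sI := hasCompactSupport_lineDeriv hs I
  have sΔ := hasCompactSupport_planeLaplacian hs
  have A : ∫ z, χ z * h z * planeLaplacian g z = ∫ z, planeLaplacian (fun y => χ y * h y) z * g z :=
    integral_mul_planeLaplacian (hχ.mul hh) hs.mul_right hg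
  have B : ∫ z, χ z * g z * lineDeriv ℝ D z e = -∫ z, lineDeriv ℝ (fun y => χ y * g y) z e * D z :=
    integral_mul_lineDeriv (h1 (hχ.mul hg)) hs.mul_right (h1 hD) e
  set E : ℂ → ℝ := fun z => planeLaplacian χ z * h z +
    2 * (lineDeriv ℝ χ z 1 * lineDeriv ℝ h z 1 + lineDeriv ℝ χ z I * lineDeriv ℝ h z I) -
    2 * (lineDeriv ℝ χ z e * D z) with hE
  have cE : Continuous E := by fun_prop
  have iE : Integrable fun z => E z * g z := (cE.mul hgc).integrable_of_hasCompactSupport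
    ((((sΔ.mul_right).add ((s1.mul_right.add sI.mul_right).mul_left)).sub
      se.mul_right.mul_left).mul_right)
  have ip : Integrable fun z => χ z * (D z * lineDeriv ℝ g z e) :=
    (hχc.mul (hDc.mul cge)).integrable_of_hasCompactSupport hs.mul_right
  have i1 : Integrable fun z => χ z * g z * lineDeriv ℝ D z e :=
    ((hχc.mul hgc).mul cDe).integrable_of_hasCompactSupport hs.mul_right.mul_right
  have i2 : Integrable fun z => χ z * h z * planeLaplacian g z :=
    ((hχc.mul hhc).mul cgΔ).integrable_of_hasCompactSupport hs.mul_right.mul_right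
  have i3 : Integrable fun z => lineDeriv ℝ χ z e * g z * D z :=
    ((cχe.mul hgc).mul hDc).integrable_of_hasCompactSupport se.mul_right.mul_right
  have B' : ∫ z, χ z * g z * lineDeriv ℝ D z e = -(∫ z, lineDeriv ℝ χ z e * g z * D z) -
      ∫ z, χ z * (D z * lineDeriv ℝ g z e) := by
    rw [B, ← neg_add', ← integral_add i3 ip]
    refine congrArg _ (integral_congr_ae (ae_of_all _ fun z => ?_))
    simp only [lineDeriv_mul_of_contDiff (h1 hχ) (h1 hg)]
    ring
  have A' : ∫ z, χ z * h z * planeLaplacian g z = (∫ z, χ z * g z * lineDeriv ℝ D z e) +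
      (∫ z, E z * g z) + 2 * ∫ z, lineDeriv ℝ χ z e * g z * D z := by
    have i4 : Integrable fun z => χ z * g z * lineDeriv ℝ D z e + E z * g z := i1.add iE
    rw [A, ← integral_const_mul, ← integral_add i1 iE, ← integral_add i4 (i3.const_mul 2)]
    refine integral_congr_ae (ae_of_all _ fun z => ?_)
    simp only [planeLaplacian_mul hχ hh, hhD, hE]
    ring
  have T : ∫ z, χ z * (lineDeriv ℝ D z e * g z + h z * planeLaplacian g z) =
      (∫ z, χ z * g z * lineDeriv ℝ D z e) + ∫ z, χ z * h z * planeLaplacian g z := by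
    rw [← integral_add i1 i2]
    refine integral_congr_ae (ae_of_all _ fun z => ?_)
    ring
  have bE : -∫ z, E z * g z ≤ 7 * κ * M * N := by
    have pE : ∀ z, |E z| ≤ 7 * κ * M := fun z => by
      have m : ∀ {a b : ℝ}, |a| ≤ κ → |b| ≤ M → |a * b| ≤ κ * M := fun ha hb => by
        rw [abs_mul]; exact mul_le_mul ha hb (abs_nonneg _) hκ
      have m1 := abs_le.1 (m (hχΔ z) (hhM z))
      have m2 := abs_le.1 (m (hχ1 z) (hh1 z))
      have m3 := abs_le.1 (m (hχI z) (hhI z))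
      have m4 := abs_le.1 (m (hχe z) (hDM z))
      rw [abs_le]
      constructor <;> simp only [hE] <;> linarith
    calc -∫ z, E z * g z ≤ ∫ z, 7 * κ * M * |g z| := by
          rw [← integral_neg]
          refine integral_mono iE.neg (hgi.abs.const_mul _) fun z => ?_
          refine (neg_le_abs _).trans ?_
          rw [abs_mul]
          exact mul_le_mul_of_nonneg_right (pE z) (abs_nonneg _)
      _ ≤ 7 * κ * M * N := by
          rw [integral_const_mul]
          exact mul_le_mul_of_nonneg_left hgN (by positivity)
  rw [T, A', B']
  linarith

/-- Slowly varying cutoff functions. -/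
lemma exists_cutoff {K : Set ℂ} (hK : IsCompact K) {κ : ℝ} (hκ : 0 < κ) :
    ∃ χ : ℂ → ℝ, ContDiff ℝ (⊤ : ℕ∞) χ ∧ HasCompactSupport χ ∧ (∀ z, 0 ≤ χ z) ∧ (∀ z, χ z ≤ 1) ∧
      (∀ z ∈ K, χ z = 1) ∧ (∀ z, |lineDeriv ℝ χ z 1| ≤ κ) ∧ (∀ z, |lineDeriv ℝ χ z I| ≤ κ) ∧
      ∀ z, |planeLaplacian χ z| ≤ κ := by
  let η : ContDiffBump (0 : ℂ) := ⟨1, 2, one_pos, one_lt_two⟩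
  have hη : ContDiff ℝ (⊤ : ℕ∞) η := η.contDiff
  have bd : ∀ {f : ℂ → ℝ}, Continuous f → HasCompactSupport f → ∃ C, ∀ z, |f z| ≤ C :=
    fun hf hs => hs.exists_bound_of_continuous hf
  obtain ⟨C₁, hC₁⟩ := bd (contDiff_lineDeriv_of_contDiff hη 1).continuous
    (hasCompactSupport_lineDeriv η.hasCompactSupport 1)
  obtain ⟨C₂, hC₂⟩ := bd (contDiff_lineDeriv_of_contDiff hη I).continuous
    (hasCompactSupport_lineDeriv η.hasCompactSupport I)
  obtain ⟨C₃, hC₃⟩ := bd (continuous_planeLaplacian hη)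
    (hasCompactSupport_planeLaplacian η.hasCompactSupport)
  obtain ⟨R, hR⟩ := hK.isBounded.exists_norm_le
  have ev : ∀ C : ℝ, ∀ᶠ ε : ℝ in 𝓝[>] 0, ε * C < κ := fun C =>
    (((continuous_id.mul continuous_const).tendsto' (0 : ℝ) 0 (by simp)).mono_left
      nhdsWithin_le_nhds).eventually (gt_mem_nhds hκ)
  have ev2 : ∀ᶠ ε : ℝ in 𝓝[>] 0, ε * R < 1 :=
    (((continuous_id.mul continuous_const).tendsto' (0 : ℝ) 0 (by simp)).mono_left
      nhdsWithin_le_nhds).eventually (gt_mem_nhds one_pos)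
  have ev3 : ∀ᶠ ε : ℝ in 𝓝[>] 0, ε * (ε * C₃) < κ :=
    (((continuous_id.mul (continuous_id.mul continuous_const)).tendsto' (0 : ℝ) 0
      (by simp)).mono_left nhdsWithin_le_nhds).eventually (gt_mem_nhds hκ)
  obtain ⟨ε, ⟨⟨⟨e1, e2⟩, e3⟩, e4⟩, e0⟩ :=
    ((((ev C₁).and (ev C₂)).and ev3).and ev2 |>.and self_mem_nhdsWithin).exists
  have e0 : 0 < ε := e0
  have sc : ∀ {k : ℂ → ℝ}, ContDiff ℝ 1 k → ∀ z e, lineDeriv ℝ (fun y : ℂ => k (ε • y)) z e =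
      ε * lineDeriv ℝ k (ε • z) e := fun {k} hk z e => by
    have hl : HasLineDerivAt ℝ k (lineDeriv ℝ k (ε • z) e) (ε • z) e :=
      ((hk.differentiable (by simp)) _).lineDifferentiableAt.hasLineDerivAt
    have h2 : HasDerivAt (fun s : ℝ => k (ε • z + s • e)) (lineDeriv ℝ k (ε • z) e) (ε * 0) := by
      rw [mul_zero]; exact hl
    have h3 := h2.comp (0 : ℝ) ((hasDerivAt_id (0 : ℝ)).const_mul ε)
    refine HasLineDerivAt.lineDeriv (hasDerivAt_of_eq h3 (fun s => ?_) (by ring))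
    simp only [Function.comp, smul_add, smul_smul]
  have h1 : ∀ {k : ℂ → ℝ}, ContDiff ℝ (⊤ : ℕ∞) k → ContDiff ℝ 1 k := fun hk => hk.of_le (by simp)
  have d2 : ∀ z e, lineDeriv ℝ (fun y => lineDeriv ℝ (fun y : ℂ => η (ε • y)) y e) z e =
      ε * (ε * lineDeriv ℝ (fun y => lineDeriv ℝ η y e) (ε • z) e) := fun z e => by
    have : (fun y => lineDeriv ℝ (fun y : ℂ => η (ε • y)) y e) =
        fun y => (fun w => ε * lineDeriv ℝ η w e) (ε • y) := funext fun y => sc (h1 hη) y e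
    have hl := contDiff_lineDeriv_of_contDiff hη e
    rw [this, sc (h1 (contDiff_const.mul hl)),
      lineDeriv_mul_of_contDiff contDiff_const (h1 hl)]
    simp [lineDeriv]
  refine ⟨fun z => η (ε • z), hη.comp (by fun_prop), ?_, fun z => η.nonneg, fun z => η.le_one,
    fun z hz => ?_, fun z => ?_, fun z => ?_, fun z => ?_⟩
  · exact η.hasCompactSupport.comp_homeomorph (Homeomorph.smulOfNeZero ε e0.ne')
  · refine η.one_of_mem_closedBall ?_
    rw [mem_closedBall_zero_iff, norm_smul, Real.norm_of_nonneg e0.le]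
    exact ((mul_le_mul_of_nonneg_left (hR z hz) e0.le).trans e4.le)
  · rw [sc (h1 hη), abs_mul, abs_of_pos e0]
    exact (mul_le_mul_of_nonneg_left (hC₁ _) e0.le).trans e1.le
  · rw [sc (h1 hη), abs_mul, abs_of_pos e0]
    exact (mul_le_mul_of_nonneg_left (hC₂ _) e0.le).trans e2.le
  · have : planeLaplacian (fun y : ℂ => η (ε • y)) z = ε * (ε * planeLaplacian η (ε • z)) := by
      simp only [planeLaplacian, d2]
      ring
    rw [this, abs_mul, abs_mul, abs_of_pos e0]
    exact (mul_le_mul_of_nonneg_left (mul_le_mul_of_nonneg_left (hC₃ _) e0.le) e0.le).trans e3.le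

end Plane

section Slices

variable {f : ℂ × ℝ → ℝ} {χ : ℂ → ℝ} {t : ℝ}

lemma contDiff_slice (hf : ContDiffOn ℝ (⊤ : ℕ∞) f upper) (ht : 0 < t) :
    ContDiff ℝ (⊤ : ℕ∞) fun z => f (z, t) :=
  contDiffOn_univ.1 (hf.comp (f := fun z : ℂ => (z, t)) (ContDiff.contDiffOn (by fun_prop))
    (fun _ _ => ht))

lemma lineDeriv_slice (f : ℂ × ℝ → ℝ) (t : ℝ) (z e : ℂ) :
    lineDeriv ℝ (fun y => f (y, t)) z e = lineDeriv ℝ f (z, t) (e, 0) := by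
  simp [lineDeriv]

lemma planeLaplacian_slice (f : ℂ × ℝ → ℝ) (t : ℝ) (z : ℂ) :
    planeLaplacian (fun y => f (y, t)) z = spaceLaplacian f (z, t) := by
  simp only [planeLaplacian, spaceLaplacian, lineDeriv_slice f]
  rw [lineDeriv_slice (fun y => lineDeriv ℝ f y (1, 0)),
    lineDeriv_slice (fun y => lineDeriv ℝ f y (I, 0))]

lemma hasDerivAt_integral_slice (hχ : Continuous χ) (hs : HasCompactSupport χ)
    (hf : ContDiffOn ℝ (⊤ : ℕ∞) f upper) (ht : 0 < t) :
    HasDerivAt (fun s => ∫ z, χ z * f (z, s)) (∫ z, χ z * lineDeriv ℝ f (z, t) (0, 1)) t := by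
  refine hasDerivAt_integral_of_isCompact (F := fun s z => χ z * f (z, s))
    (F' := fun s z => χ z * lineDeriv ℝ f (z, s) (0, 1)) (a := 0) (b := t + 1)
    ⟨ht, by linarith⟩ hs ?_ ?_ ?_ ?_ ?_
  · intro s _ w hw
    simp [image_eq_zero_of_notMem_tsupport hw]
  · intro s _ w hw
    simp [image_eq_zero_of_notMem_tsupport hw]
  · exact fun s hs' => hχ.mul (contDiff_slice hf hs'.1).continuous
  · have h := (contDiffOn_lineDeriv hf (0, 1)).continuousOn
    exact (hχ.comp continuous_snd).continuousOn.mul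
      (h.comp (f := fun y : ℝ × ℂ => (y.2, y.1)) (by fun_prop) fun y hy => hy.1.1)
  · intro s hs' w
    refine HasDerivAt.const_mul (χ w) ?_
    have h := hasLineDerivAt_of_contDiffOn hf (x := (w, 0) + s • ((0 : ℂ), (1 : ℝ)))
      (by simpa [upper] using hs'.1) (0, 1)
    refine hasDerivAt_of_eq (HasLineDerivAt.hasDerivAt_line h) (fun r => by simp) (by simp)

end Slices

/-- The energy inequality along the heat flow, localised by a cutoff `χ`. -/
lemma integral_cutoff_le {χ : ℂ → ℝ} {B H G D : ℂ × ℝ → ℝ} {e : ℂ} {κ M N K δ T : ℝ}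
    (hχ : ContDiff ℝ (⊤ : ℕ∞) χ) (hs : HasCompactSupport χ) (hχ0 : ∀ z, 0 ≤ χ z)
    (hχle : ∀ z, χ z ≤ 1) (hχe : ∀ z, |lineDeriv ℝ χ z e| ≤ κ)
    (hχ1 : ∀ z, |lineDeriv ℝ χ z 1| ≤ κ) (hχI : ∀ z, |lineDeriv ℝ χ z I| ≤ κ)
    (hχΔ : ∀ z, |planeLaplacian χ z| ≤ κ)
    (hB : ContDiffOn ℝ (⊤ : ℕ∞) B upper) (hH : ContDiffOn ℝ (⊤ : ℕ∞) H upper)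
    (hG : ContDiffOn ℝ (⊤ : ℕ∞) G upper) (hD : ContDiffOn ℝ (⊤ : ℕ∞) D upper)
    (hHt : ∀ x ∈ upper, lineDeriv ℝ H x (0, 1) = spaceLaplacian H x)
    (hGt : ∀ x ∈ upper, lineDeriv ℝ G x (0, 1) = spaceLaplacian G x)
    (hHD : ∀ x ∈ upper, spaceLaplacian H x = lineDeriv ℝ D x (e, 0))
    (hBD : ∀ x ∈ upper, |D x * lineDeriv ℝ G x (e, 0)| ≤ heatOp B x)
    (hB0 : ∀ x ∈ upper, 0 ≤ B x) (hBi : ∀ t, 0 < t → Integrable fun z => B (z, t))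
    (hBK : ∀ t, 0 < t → ∫ z, B (z, t) ≤ K)
    (hGi : ∀ t, 0 < t → Integrable fun z => G (z, t))
    (hGN : ∀ t, 0 < t → ∫ z, |G (z, t)| ≤ N) (hκ : 0 ≤ κ) (hM : 0 ≤ M)
    (hDM : ∀ x ∈ upper, |D x| ≤ M) (hHM : ∀ x ∈ upper, |H x| ≤ M)
    (hH1 : ∀ x ∈ upper, |lineDeriv ℝ H x (1, 0)| ≤ M)
    (hHI : ∀ x ∈ upper, |lineDeriv ℝ H x (I, 0)| ≤ M) (hδ : 0 < δ) (hδT : δ ≤ T) :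
    ∫ z, χ z * (H (z, δ) * G (z, δ)) ≤
      2 * K + (∫ z, χ z * (H (z, T) * G (z, T))) + (2 * κ * K + 7 * κ * M * N) * T := by
  have hχc := hχ.continuous
  have hHG : ContDiffOn ℝ (⊤ : ℕ∞) (fun x => H x * G x) upper := hH.mul hG
  have dB := fun (t : ℝ) (ht : 0 < t) => hasDerivAt_integral_slice hχc hs hB ht
  have dHG := fun (t : ℝ) (ht : 0 < t) => hasDerivAt_integral_slice hχc hs hHG ht
  have hT : 0 < T := hδ.trans_le hδT
  have hN : 0 ≤ N := (integral_nonneg fun z => abs_nonneg _).trans (hGN T hT)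
  have JB0 : ∀ t, 0 < t → 0 ≤ ∫ z, χ z * B (z, t) := fun t ht =>
    integral_nonneg fun z => mul_nonneg (hχ0 z) (hB0 (z, t) ht)
  have iB : ∀ t, 0 < t → Integrable fun z => χ z * B (z, t) := fun t ht =>
    (hχc.mul (contDiff_slice hB ht).continuous).integrable_of_hasCompactSupport hs.mul_right
  have JBK : ∀ t, 0 < t → ∫ z, χ z * B (z, t) ≤ K := fun t ht =>
    (integral_mono (iB t ht) (hBi t ht) fun z =>
      mul_le_of_le_one_left (hB0 (z, t) ht) (hχle z)).trans (hBK t ht)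
  have hK : 0 ≤ K := (JB0 T hT).trans (JBK T hT)
  have bound : ∀ t, 0 < t → 2 * (∫ z, χ z * lineDeriv ℝ B (z, t) (0, 1)) -
      ∫ z, χ z * lineDeriv ℝ (fun x => H x * G x) (z, t) (0, 1) ≤
        2 * κ * K + 7 * κ * M * N := by
    intro t ht
    have sB := contDiff_slice hB ht
    have sH := contDiff_slice hH ht
    have sG := contDiff_slice hG ht
    have sD := contDiff_slice hD ht
    have hup : ∀ z : ℂ, (z, t) ∈ upper := fun z => ht
    have err := neg_integral_cutoff_le (e := e) hχ hs sH sG sD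
      (fun z => by rw [planeLaplacian_slice, lineDeriv_slice, hHD _ (hup z)]) (hGi t ht) (hGN t ht)
      hκ hM hχe hχ1 hχI hχΔ (fun z => hDM _ (hup z)) (fun z => hHM _ (hup z))
      (fun z => by rw [lineDeriv_slice]; exact hH1 _ (hup z))
      (fun z => by rw [lineDeriv_slice]; exact hHI _ (hup z))
    simp only [planeLaplacian_slice, lineDeriv_slice] at err
    have tHG : ∀ z, lineDeriv ℝ (fun x => H x * G x) (z, t) (0, 1) =
        lineDeriv ℝ D (z, t) (e, 0) * G (z, t) + H (z, t) * spaceLaplacian G (z, t) := fun z => by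
      have h := (HasDerivAt.mul (hasLineDerivAt_of_contDiffOn hH (hup z) (0, 1))
        (hasLineDerivAt_of_contDiffOn hG (hup z) (0, 1))).deriv
      simp only [zero_smul, add_zero] at h
      rw [← hGt _ (hup z), ← hHD _ (hup z), ← hHt _ (hup z)]
      exact h
    simp only [tHG]
    have lB : ∫ z, χ z * spaceLaplacian B (z, t) ≤ κ * K := by
      have h := integral_mul_planeLaplacian hχ hs sB
      simp only [planeLaplacian_slice] at h
      rw [h]
      refine (integral_mono (((continuous_planeLaplacian hχ).mul
        sB.continuous).integrable_of_hasCompactSupport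
        (hasCompactSupport_planeLaplacian hs).mul_right) ((hBi t ht).const_mul κ) fun z =>
        mul_le_mul_of_nonneg_right ((le_abs_self _).trans (hχΔ z)) (hB0 _ (hup z))).trans ?_
      rw [integral_const_mul]
      exact mul_le_mul_of_nonneg_left (hBK t ht) hκ
    have cΔ : Continuous fun z => spaceLaplacian B (z, t) := by
      simp only [← planeLaplacian_slice]
      exact continuous_planeLaplacian sB
    have ct : Continuous fun z => lineDeriv ℝ B (z, t) (0, 1) :=
      (contDiff_slice (contDiffOn_lineDeriv hB (0, 1)) ht).continuous
    have cG : Continuous fun z => lineDeriv ℝ G (z, t) (e, 0) :=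
      (contDiff_slice (contDiffOn_lineDeriv hG (e, 0)) ht).continuous
    have iΔ : Integrable fun z => χ z * spaceLaplacian B (z, t) :=
      (hχc.mul cΔ).integrable_of_hasCompactSupport hs.mul_right
    have it : Integrable fun z => χ z * lineDeriv ℝ B (z, t) (0, 1) :=
      (hχc.mul ct).integrable_of_hasCompactSupport hs.mul_right
    have iD : Integrable fun z => χ z * (D (z, t) * lineDeriv ℝ G (z, t) (e, 0)) :=
      (hχc.mul (sD.continuous.mul cG)).integrable_of_hasCompactSupport hs.mul_right
    have key : (∫ z, χ z * (D (z, t) * lineDeriv ℝ G (z, t) (e, 0))) ≤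
        (∫ z, χ z * spaceLaplacian B (z, t)) - ∫ z, χ z * lineDeriv ℝ B (z, t) (0, 1) := by
      rw [← integral_sub iΔ it]
      refine integral_mono iD (iΔ.sub it) fun z => ?_
      show _ ≤ χ z * spaceLaplacian B (z, t) - χ z * lineDeriv ℝ B (z, t) (0, 1)
      rw [← mul_sub]
      exact mul_le_mul_of_nonneg_left ((le_abs_self _).trans (hBD _ (hup z))) (hχ0 z)
    linarith
  have dΦ := fun (t : ℝ) (ht : 0 < t) => ((dB t ht).const_mul 2).sub (dHG t ht)
  have mean := (convex_Ioi (0 : ℝ)).image_sub_le_mul_sub_of_deriv_le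
    (f := fun t => 2 * (∫ z, χ z * B (z, t)) - ∫ z, χ z * (H (z, t) * G (z, t)))
    (C := 2 * κ * K + 7 * κ * M * N)
    (fun t ht => (dΦ t ht).continuousAt.continuousWithinAt)
    (fun t ht => (dΦ t (interior_subset ht)).differentiableAt.differentiableWithinAt)
    (fun t ht => by
      have h := (dΦ t (interior_subset ht)).deriv
      refine le_of_eq_of_le h (bound t (interior_subset ht))) δ hδ T hT hδT
  have hC : (2 * κ * K + 7 * κ * M * N) * (T - δ) ≤ (2 * κ * K + 7 * κ * M * N) * T :=
    mul_le_mul_of_nonneg_left (by linarith) (by positivity)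
  have := JB0 T hT
  have := JBK δ hδ
  linarith

section Limit

variable {h g : ℂ → ℝ}

lemma tendsto_integral_cutoff {χ : ℂ → ℝ} (hχ : Continuous χ) (hsχ : HasCompactSupport χ)
    (hh : Continuous h) (hsh : HasCompactSupport h) (hg : Continuous g)
    (hsg : HasCompactSupport g) :
    Tendsto (fun δ => ∫ z, χ z * (heatExt h (z, δ) * heatExt g (z, δ))) (𝓝[>] 0)
      (𝓝 (∫ z, χ z * (h z * g z))) := by
  obtain ⟨C₁, hC₁⟩ := hsh.exists_bound_of_continuous hh
  obtain ⟨C₂, hC₂⟩ := hsg.exists_bound_of_continuous hg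
  refine tendsto_integral_filter_of_dominated_convergence (fun z => |χ z| * (C₁ * C₂)) ?_ ?_
    ((hχ.integrable_of_hasCompactSupport hsχ).abs.mul_const _) (ae_of_all _ fun z =>
      ((tendsto_heatExt_zero hh hsh z).mul (tendsto_heatExt_zero hg hsg z)).const_mul _)
  · filter_upwards [self_mem_nhdsWithin] with δ hδ
    exact (hχ.mul ((contDiff_heatExt_slice hh hsh hδ).continuous.mul
      (contDiff_heatExt_slice hg hsg hδ).continuous)).aestronglyMeasurable
  · filter_upwards [self_mem_nhdsWithin] with δ hδ
    refine ae_of_all _ fun z => ?_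
    rw [Real.norm_eq_abs, abs_mul, abs_mul]
    have b₁ := abs_heatExt_le_of_bound hC₁ (x := (z, δ)) hδ
    have b₂ := abs_heatExt_le_of_bound hC₂ (x := (z, δ)) hδ
    exact mul_le_mul_of_nonneg_left (mul_le_mul b₁ b₂ (abs_nonneg _) ((abs_nonneg _).trans b₁))
      (abs_nonneg _)

lemma integral_cutoff_heatExt_le {χ : ℂ → ℝ} (hχ : Continuous χ) (hsχ : HasCompactSupport χ)
    (hχ0 : ∀ z, 0 ≤ χ z) (hχ1 : ∀ z, χ z ≤ 1)
    (hh : Continuous h) (hsh : HasCompactSupport h) (hg : Continuous g)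
    (hsg : HasCompactSupport g) {T : ℝ} (hT : 0 < T) :
    ∫ z, χ z * (heatExt h (z, T) * heatExt g (z, T)) ≤
      (∫ z, |h z|) * (4 * Real.pi * T)⁻¹ * ∫ z, |g z| := by
  set A := (∫ z, |h z|) * (4 * Real.pi * T)⁻¹
  have hA : 0 ≤ A := mul_nonneg (integral_nonneg fun z => abs_nonneg _) (by positivity)
  have i1 : Integrable fun z => χ z * (heatExt h (z, T) * heatExt g (z, T)) :=
    (hχ.mul ((contDiff_heatExt_slice hh hsh hT).continuous.mul
      (contDiff_heatExt_slice hg hsg hT).continuous)).integrable_of_hasCompactSupport hsχ.mul_right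
  refine (integral_mono i1 ((integrable_heatExt_slice hg hsg hT).abs.const_mul A)
    fun z => ?_).trans ?_
  · refine (le_abs_self _).trans ?_
    rw [abs_mul, abs_mul, abs_of_nonneg (hχ0 z)]
    exact (mul_le_of_le_one_left (by positivity) (hχ1 z)).trans
      (mul_le_mul_of_nonneg_right (abs_heatExt_le_integral hh hsh (x := (z, T)) hT) (abs_nonneg _))
  · rw [integral_const_mul]
    exact mul_le_mul_of_nonneg_left (integral_abs_heatExt_slice_le hg hsg hT) hA

/-- Duality estimate obtained by integrating the energy inequality over all times. -/
lemma integral_mul_le_of_energy {B D : ℂ × ℝ → ℝ} {e : ℂ} {M K : ℝ} (he : e = 1 ∨ e = I)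
    (hh : ContDiff ℝ (⊤ : ℕ∞) h) (hsh : HasCompactSupport h) (hg : Continuous g)
    (hsg : HasCompactSupport g) (hB : ContDiffOn ℝ (⊤ : ℕ∞) B upper)
    (hD : ContDiffOn ℝ (⊤ : ℕ∞) D upper)
    (hHD : ∀ x ∈ upper, spaceLaplacian (heatExt h) x = lineDeriv ℝ D x (e, 0))
    (hBD : ∀ x ∈ upper, |D x * lineDeriv ℝ (heatExt g) x (e, 0)| ≤ heatOp B x)
    (hB0 : ∀ x ∈ upper, 0 ≤ B x) (hBi : ∀ t, 0 < t → Integrable fun z => B (z, t))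
    (hBK : ∀ t, 0 < t → ∫ z, B (z, t) ≤ K) (hDM : ∀ x ∈ upper, |D x| ≤ M) :
    ∫ z, h z * g z ≤ 2 * K := by
  have h1 : ContDiff ℝ 1 h := hh.of_le (by simp)
  have hhc := hh.continuous
  obtain ⟨C₀, hC₀⟩ := hsh.exists_bound_of_continuous hhc
  obtain ⟨C₁, hC₁⟩ := (hasCompactSupport_lineDeriv hsh 1).exists_bound_of_continuous
    (continuous_lineDeriv_of_contDiff h1 1)
  obtain ⟨C₂, hC₂⟩ := (hasCompactSupport_lineDeriv hsh I).exists_bound_of_continuous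
    (continuous_lineDeriv_of_contDiff h1 I)
  set M' := |M| + |C₀| + |C₁| + |C₂| with hM'
  have hM0 : 0 ≤ M' := by positivity
  have b1 : M ≤ M' := by linarith [le_abs_self M, abs_nonneg C₀, abs_nonneg C₁, abs_nonneg C₂]
  have b2 : C₀ ≤ M' := by linarith [le_abs_self C₀, abs_nonneg M, abs_nonneg C₁, abs_nonneg C₂]
  have b3 : C₁ ≤ M' := by linarith [le_abs_self C₁, abs_nonneg M, abs_nonneg C₀, abs_nonneg C₂]
  have b4 : C₂ ≤ M' := by linarith [le_abs_self C₂, abs_nonneg M, abs_nonneg C₀, abs_nonneg C₁]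
  set N := ∫ z, |g z| with hN
  have step : ∀ T : ℝ, 0 < T → ∫ z, h z * g z ≤
      2 * K + ((∫ z, |h z|) * (4 * Real.pi)⁻¹ * N + (2 * K + 7 * M' * N)) * T⁻¹ := by
    intro T hT
    obtain ⟨χ, hχ, hsχ, hχ0, hχle, hχK, hχ1, hχI, hχΔ⟩ :=
      exists_cutoff hsh.isCompact (κ := T⁻¹ * T⁻¹) (by positivity)
    have hχe : ∀ z, |lineDeriv ℝ χ z e| ≤ T⁻¹ * T⁻¹ := by
      rcases he with rfl | rfl
      · exact hχ1
      · exact hχI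
    have lim := tendsto_integral_cutoff hχ.continuous hsχ hhc hsh hg hsg
    have hχh : ∀ z, χ z * (h z * g z) = h z * g z := fun z => by
      by_cases hz : z ∈ tsupport h
      · rw [hχK z hz, one_mul]
      · simp [image_eq_zero_of_notMem_tsupport hz]
    simp only [hχh] at lim
    refine le_of_tendsto lim ?_
    filter_upwards [Ioc_mem_nhdsGT hT] with δ hδ
    have main := integral_cutoff_le (e := e) (M := M') (N := N) (K := K) hχ hsχ hχ0 hχle hχe hχ1
      hχI hχΔ hB (contDiffOn_heatExt hhc hsh) (contDiffOn_heatExt hg hsg) hD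
      (fun x hx => lineDeriv_heatExt_time hhc hsh hx)
      (fun x hx => lineDeriv_heatExt_time hg hsg hx) hHD hBD hB0 hBi hBK
      (fun t ht => integrable_heatExt_slice hg hsg ht)
      (fun t ht => integral_abs_heatExt_slice_le hg hsg ht) (by positivity) hM0
      (fun x hx => (hDM x hx).trans b1)
      (fun x hx => (abs_heatExt_le_of_bound hC₀ hx).trans b2)
      (fun x hx => by
        rw [lineDeriv_heatExt h1 hsh 1 hx]
        exact (abs_heatExt_le_of_bound hC₁ hx).trans b3)
      (fun x hx => by
        rw [lineDeriv_heatExt h1 hsh I hx]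
        exact (abs_heatExt_le_of_bound hC₂ hx).trans b4) hδ.1 hδ.2
    have tail := integral_cutoff_heatExt_le hχ.continuous hsχ hχ0 hχle hhc hsh hg hsg hT
    have e1 : (2 * (T⁻¹ * T⁻¹) * K + 7 * (T⁻¹ * T⁻¹) * M' * N) * T =
        (2 * K + 7 * M' * N) * T⁻¹ := by
      field_simp
    have e2 : (∫ z, |h z|) * (4 * Real.pi * T)⁻¹ * N =
        (∫ z, |h z|) * (4 * Real.pi)⁻¹ * N * T⁻¹ := by
      rw [mul_inv]
      ring
    rw [e1] at main
    rw [e2] at tail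
    linarith
  refine ge_of_tendsto (x := atTop) (f := fun T : ℝ =>
    2 * K + ((∫ z, |h z|) * (4 * Real.pi)⁻¹ * N + (2 * K + 7 * M' * N)) * T⁻¹) ?_ ?_
  · simpa using (tendsto_inv_atTop_zero.const_mul
      ((∫ z, |h z|) * (4 * Real.pi)⁻¹ * N + (2 * K + 7 * M' * N))).const_add (2 * K)
  · filter_upwards [Ioi_mem_atTop 0] with T hT using step T hT

end Limit

section Commute

variable {f : ℂ → ℝ}

lemma lineDeriv_lineDeriv_comm (hf : ContDiff ℝ (⊤ : ℕ∞) f) (z a b : ℂ) :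
    lineDeriv ℝ (fun y => lineDeriv ℝ f y a) z b =
      lineDeriv ℝ (fun y => lineDeriv ℝ f y b) z a := by
  have h1 : ContDiff ℝ 1 f := hf.of_le (by simp)
  have hd : DifferentiableAt ℝ (fderiv ℝ f) z :=
    ((hf.fderiv_right (m := (⊤ : ℕ∞)) (by simp)).differentiable (by simp)) z
  have key : ∀ a b, lineDeriv ℝ (fun y => lineDeriv ℝ f y a) z b =
      fderiv ℝ (fderiv ℝ f) z b a := fun a b => by
    rw [lineDeriv_eq_fderiv_of_contDiff
      ((contDiff_lineDeriv_of_contDiff hf a).of_le (by simp))]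
    simp only [lineDeriv_eq_fderiv_of_contDiff h1]
    rw [fderiv_clm_apply hd (differentiableAt_const a)]
    simp
  rw [key, key]
  exact (hf.contDiffAt.isSymmSndFDerivAt
    (by simpa using WithTop.coe_le_coe.2 (le_top : (2 : ℕ∞) ≤ ⊤))) b a

lemma lineDeriv_add_plane {g : ℂ → ℝ} (hf : ContDiff ℝ 1 f) (hg : ContDiff ℝ 1 g) (z e : ℂ) :
    lineDeriv ℝ (fun y => f y + g y) z e = lineDeriv ℝ f z e + lineDeriv ℝ g z e := by
  rw [lineDeriv_eq_fderiv_of_contDiff (hf.add hg), lineDeriv_eq_fderiv_of_contDiff hf,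
    lineDeriv_eq_fderiv_of_contDiff hg, fderiv_fun_add (hf.differentiable (by simp) z)
    (hg.differentiable (by simp) z)]
  rfl

lemma planeLaplacian_lineDeriv (hf : ContDiff ℝ (⊤ : ℕ∞) f) (z e : ℂ) :
    planeLaplacian (fun y => lineDeriv ℝ f y e) z = lineDeriv ℝ (planeLaplacian f) z e := by
  have c : ∀ a, ContDiff ℝ (⊤ : ℕ∞) fun y => lineDeriv ℝ f y a := contDiff_lineDeriv_of_contDiff hf
  have cc : ∀ a, ContDiff ℝ 1 fun y => lineDeriv ℝ (fun w => lineDeriv ℝ f w a) y a :=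
    fun a => (contDiff_lineDeriv_of_contDiff (c a) a).of_le (by simp)
  have comm : ∀ a, (fun y => lineDeriv ℝ (fun w => lineDeriv ℝ f w e) y a) =
      fun y => lineDeriv ℝ (fun w => lineDeriv ℝ f w a) y e :=
    fun a => funext fun y => lineDeriv_lineDeriv_comm hf y e a
  have e1 : planeLaplacian f = fun y => lineDeriv ℝ (fun w => lineDeriv ℝ f w 1) y 1 +
    lineDeriv ℝ (fun w => lineDeriv ℝ f w I) y I := rfl
  rw [e1, lineDeriv_add_plane (cc 1) (cc I)]
  simp only [planeLaplacian, comm]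
  rw [lineDeriv_lineDeriv_comm (c 1), lineDeriv_lineDeriv_comm (c I)]

lemma spaceLaplacian_heatExt (hf : ContDiff ℝ (⊤ : ℕ∞) f) (hs : HasCompactSupport f) {x : ℂ × ℝ}
    (hx : x ∈ upper) : spaceLaplacian (heatExt f) x = heatExt (planeLaplacian f) x := by
  have c : ∀ a, ContDiff ℝ (⊤ : ℕ∞) fun y => lineDeriv ℝ f y a := contDiff_lineDeriv_of_contDiff hf
  have key : ∀ a, lineDeriv ℝ (fun y => lineDeriv ℝ (heatExt f) y (a, 0)) x (a, 0) =
      heatExt (fun z => lineDeriv ℝ (fun y => lineDeriv ℝ f y a) z a) x := fun a => by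
    rw [lineDeriv_congr_upper (fun y hy => lineDeriv_heatExt (hf.of_le (by simp)) hs a hy) hx,
      lineDeriv_heatExt ((c a).of_le (by simp)) (hasCompactSupport_lineDeriv hs a) a hx]
  have i : ∀ a, Integrable fun w => lineDeriv ℝ (fun y => lineDeriv ℝ f y a) w a *
      heatKernel (x.1 - w, x.2) := fun a =>
    integrable_mul_heatKernel (contDiff_lineDeriv_of_contDiff (c a) a).continuous
      (hasCompactSupport_lineDeriv (hasCompactSupport_lineDeriv hs a) a) hx
  simp only [spaceLaplacian, key]
  simp only [heatExt, kernelConv, planeLaplacian, add_mul]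
  rw [integral_add (i 1) (i I)]

lemma heatExt_add {φ ψ : ℂ → ℝ} (hφ : Continuous φ) (hsφ : HasCompactSupport φ) (hψ : Continuous ψ)
    (hsψ : HasCompactSupport ψ) {x : ℂ × ℝ} (hx : x ∈ upper) :
    heatExt (fun z => φ z + ψ z) x = heatExt φ x + heatExt ψ x := by
  simp only [heatExt, kernelConv, add_mul]
  exact integral_add (integrable_mul_heatKernel hφ hsφ hx) (integrable_mul_heatKernel hψ hsψ hx)

end Commute

section AbsRpow

variable {f : ℂ → ℝ} {s : ℝ}

lemma continuous_abs_rpow (hf : Continuous f) (hs : 0 ≤ s) : Continuous fun z => |f z| ^ s :=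
  hf.abs.rpow_const fun _ => Or.inr hs

lemma hasCompactSupport_abs_rpow (hf : HasCompactSupport f) (hs : 0 < s) :
    HasCompactSupport fun z => |f z| ^ s :=
  hf.comp_left (g := fun x : ℝ => |x| ^ s) (by simp [hs.ne'])

lemma integrable_abs_rpow (hf : Continuous f) (hfs : HasCompactSupport f) (hs : 0 < s) :
    Integrable fun z => |f z| ^ s :=
  (continuous_abs_rpow hf hs.le).integrable_of_hasCompactSupport (hasCompactSupport_abs_rpow hfs hs)

lemma add_add_rpow_le {a b c r : ℝ} (ha : 0 ≤ a) (hb : 0 ≤ b) (hc : 0 ≤ c) (hr : 1 ≤ r) :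
    (a + b + c) ^ r ≤ 3 ^ (r - 1) * (a ^ r + b ^ r + c ^ r) := by
  have h := Real.rpow_sum_le_const_mul_sum_rpow (Finset.univ : Finset (Fin 3)) ![a, b, c] hr
  simpa [Fin.sum_univ_three, abs_of_nonneg ha, abs_of_nonneg hb, abs_of_nonneg hc] using h

lemma sq_le_rpow {F W a : ℝ} (ha : 0 < a) (h : |F| ^ a ≤ W) : F ^ 2 ≤ W ^ (2 / a) := by
  have h' := Real.rpow_le_rpow (z := 2 / a) (by positivity) h (by positivity)
  rwa [← Real.rpow_mul (abs_nonneg F), mul_div_cancel₀ _ ha.ne', Real.rpow_two, sq_abs] at h'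

end AbsRpow

/-- Bilinear embedding: the dual form of the `L^p` estimate for the gradient of a solution of
`Δ v = ∂ₛ f₁ + ∂ₜ f₂`. -/
lemma exists_integral_lineDeriv_mul_le {p q : ℝ} (hpq : p.HolderConjugate q) :
    ∃ C : ℝ, 0 < C ∧ ∀ v f₁ f₂ g : ℂ → ℝ, ContDiff ℝ (⊤ : ℕ∞) v → HasCompactSupport v →
      ContDiff ℝ (⊤ : ℕ∞) f₁ → HasCompactSupport f₁ → ContDiff ℝ (⊤ : ℕ∞) f₂ →
      HasCompactSupport f₂ → Continuous g → HasCompactSupport g →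
      (∀ z, planeLaplacian v z = lineDeriv ℝ f₁ z 1 + lineDeriv ℝ f₂ z I) →
      ∀ e : ℂ, e = 1 ∨ e = I → ∫ z, lineDeriv ℝ v z e * g z ≤
        C * ((∫ z, |f₁ z| ^ p) + (∫ z, |f₂ z| ^ p) + ∫ z, |g z| ^ q) := by
  obtain ⟨r, hr, hrp, hrq⟩ : ∃ r, 1 < r ∧ r ≤ p ∧ r ≤ q := by
    exact ⟨min p q, lt_min hpq.lt hpq.symm.lt, min_le_left _ _, min_le_right _ _⟩
  have hr0 : 0 < r := by linarith
  have hp0 := hpq.pos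
  have hq0 := hpq.symm.pos
  set β := r * (1 - 2 / p) with hβ
  have hβ1 : r - β = 2 / (p / r) := by
    rw [hβ]
    field_simp
    ring
  have hβ2 : r + β = 2 / (q / r) := by
    have : p⁻¹ + q⁻¹ = 1 := hpq.inv_add_inv_eq_one
    have : 1 / p = 1 - 1 / q := by simp only [one_div]; linarith
    rw [hβ, div_div_eq_mul_div, mul_comm 2 r, mul_div_assoc, ← mul_one_div 2 p, this]
    ring
  have ha1 : 1 ≤ p / r := (one_le_div hr0).2 hrp
  have ha2 : 1 ≤ q / r := (one_le_div hr0).2 hrq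
  have ha1' : 0 < p / r := by linarith
  have ha2' : 0 < q / r := by linarith
  set Cb := 3 * (3 * β ^ 2 + |β|) / (r * (r - 1)) + 3 with hCb
  have hCb0 : 0 < Cb := by
    have : 0 < r - 1 := by linarith
    positivity
  refine ⟨2 * (Cb * 3 ^ (r - 1)), by positivity, ?_⟩
  intro v f₁ f₂ g hv hsv hf₁ hs₁ hf₂ hs₂ hg hsg hΔ e he
  have hRHS : 0 ≤ (∫ z, |f₁ z| ^ p) + (∫ z, |f₂ z| ^ p) + ∫ z, |g z| ^ q := by positivity
  by_cases hg0 : ∃ w, g w ≠ 0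
  swap
  · push Not at hg0
    simp only [hg0, mul_zero, integral_zero] at hRHS ⊢
    positivity
  have c₁ := continuous_abs_rpow hf₁.continuous ha1'.le
  have c₂ := continuous_abs_rpow hf₂.continuous ha1'.le
  have c₃ := continuous_abs_rpow hg ha2'.le
  have t₁ := hasCompactSupport_abs_rpow hs₁ ha1'
  have t₂ := hasCompactSupport_abs_rpow hs₂ ha1'
  have t₃ := hasCompactSupport_abs_rpow hsg ha2'
  set ω : ℂ → ℝ := fun z => |f₁ z| ^ (p / r) + |f₂ z| ^ (p / r) + |g z| ^ (q / r) with hω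
  have cω : Continuous ω := (c₁.add c₂).add c₃
  have tω : HasCompactSupport ω := (t₁.add t₂).add t₃
  have hω0 : ∀ z, 0 ≤ ω z := fun z => by positivity
  have hωpos : ∃ z, ω z ≠ 0 := by
    obtain ⟨w, hw⟩ := hg0
    have : 0 < |g w| ^ (q / r) := Real.rpow_pos_of_pos (abs_pos.2 hw) _
    exact ⟨w, (add_pos_of_nonneg_of_pos (by positivity) this).ne'⟩
  have hWpos : ∀ x ∈ upper, 0 < heatExt ω x := fun x hx => heatExt_pos cω tω hω0 hωpos hx
  have dom : ∀ {k : ℂ → ℝ} {a : ℝ}, Continuous k → HasCompactSupport k → 1 ≤ a →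
      (∀ z, |k z| ^ a ≤ ω z) → ∀ x ∈ upper, heatExt k x ^ 2 ≤ heatExt ω x ^ (2 / a) := by
    intro k a hk hsk ha hle x hx
    have ha0 : 0 < a := by linarith
    exact sq_le_rpow ha0 ((abs_heatExt_rpow_le hk hsk ha hx).trans
      (heatExt_mono (continuous_abs_rpow hk ha0.le) (hasCompactSupport_abs_rpow hsk ha0) cω tω
        hle hx))
  have d₁ := dom hf₁.continuous hs₁ ha1 fun z => by
    have : 0 ≤ |f₂ z| ^ (p / r) := by positivity
    have : 0 ≤ |g z| ^ (q / r) := by positivity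
    simp only [hω]; linarith
  have d₂ := dom hf₂.continuous hs₂ ha1 fun z => by
    have : 0 ≤ |f₁ z| ^ (p / r) := by positivity
    have : 0 ≤ |g z| ^ (q / r) := by positivity
    simp only [hω]; linarith
  have d₃ := dom hg hsg ha2 fun z => by
    have : 0 ≤ |f₁ z| ^ (p / r) := by positivity
    have : 0 ≤ |f₂ z| ^ (p / r) := by positivity
    simp only [hω]; linarith
  rw [← hβ1] at d₁ d₂
  rw [← hβ2] at d₃
  have sW := contDiffOn_heatExt cω tω
  have s₁ := contDiffOn_heatExt hf₁.continuous hs₁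
  have s₂ := contDiffOn_heatExt hf₂.continuous hs₂
  have s₃ := contDiffOn_heatExt hg hsg
  set B := bellman r β (heatExt ω) (heatExt f₁) (heatExt f₂) (heatExt g) with hB
  have sB : ContDiffOn ℝ (⊤ : ℕ∞) B upper := contDiffOn_bellman sW hWpos s₁ s₂ s₃
  have B0 : ∀ x ∈ upper, 0 ≤ B x := fun x hx => bellman_nonneg hr (hWpos x hx)
  have cωr := continuous_abs_rpow cω hr0.le
  have tωr := hasCompactSupport_abs_rpow tω hr0
  have Ble : ∀ x ∈ upper, B x ≤ Cb * heatExt (fun z => |ω z| ^ r) x := fun x hx => by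
    refine (bellman_le (hWpos x hx) (d₁ x hx) (d₂ x hx) (d₃ x hx)).trans
      (mul_le_mul_of_nonneg_left ?_ hCb0.le)
    have := abs_heatExt_rpow_le cω tω hr.le hx
    rwa [abs_of_pos (hWpos x hx)] at this
  have Bi : ∀ t, 0 < t → Integrable fun z => B (z, t) := fun t ht =>
    ((integrable_heatExt_slice cωr tωr ht).const_mul Cb).mono'
      (contDiff_slice sB ht).continuous.aestronglyMeasurable (ae_of_all _ fun z => by
        rw [Real.norm_of_nonneg (B0 (z, t) ht)]
        exact Ble (z, t) ht)
  have hωr : ∫ z, |ω z| ^ r ≤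
      3 ^ (r - 1) * ((∫ z, |f₁ z| ^ p) + (∫ z, |f₂ z| ^ p) + ∫ z, |g z| ^ q) := by
    have i₁ := integrable_abs_rpow hf₁.continuous hs₁ hp0
    have i₂ := integrable_abs_rpow hf₂.continuous hs₂ hp0
    have i₃ := integrable_abs_rpow hg hsg hq0
    have i₁₂ : Integrable fun z => |f₁ z| ^ p + |f₂ z| ^ p := i₁.add i₂
    rw [← integral_add i₁ i₂, ← integral_add i₁₂ i₃, ← integral_const_mul]
    refine integral_mono (integrable_abs_rpow cω tω hr0) ((i₁₂.add i₃).const_mul _) fun z => ?_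
    have h := add_add_rpow_le (a := |f₁ z| ^ (p / r)) (b := |f₂ z| ^ (p / r))
      (c := |g z| ^ (q / r)) (by positivity) (by positivity) (by positivity) hr.le
    simp only [← Real.rpow_mul (abs_nonneg _), div_mul_cancel₀ _ hr0.ne'] at h
    simpa only [abs_of_nonneg (hω0 z)] using h
  have BK : ∀ t, 0 < t → ∫ z, B (z, t) ≤ Cb * ∫ z, |ω z| ^ r := fun t ht => by
    rw [← integral_heatExt_slice cωr tωr ht, ← integral_const_mul]
    exact integral_mono (Bi t ht) ((integrable_heatExt_slice cωr tωr ht).const_mul Cb)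
      fun z => Ble (z, t) ht
  set d : ℂ → ℝ := fun z => lineDeriv ℝ f₁ z 1 + lineDeriv ℝ f₂ z I with hd
  have sd₁ := contDiff_lineDeriv_of_contDiff hf₁ 1
  have sd₂ := contDiff_lineDeriv_of_contDiff hf₂ I
  have td₁ := hasCompactSupport_lineDeriv hs₁ 1
  have td₂ := hasCompactSupport_lineDeriv hs₂ I
  have sd : ContDiff ℝ (⊤ : ℕ∞) d := sd₁.add sd₂
  have td : HasCompactSupport d := td₁.add td₂
  have hΔd : planeLaplacian v = d := funext hΔ
  obtain ⟨M, hM⟩ := td.exists_bound_of_continuous sd.continuous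
  have res := integral_mul_le_of_energy (B := B) (D := heatExt d) (e := e) (M := M)
    (K := Cb * ∫ z, |ω z| ^ r) he (contDiff_lineDeriv_of_contDiff hv e)
    (hasCompactSupport_lineDeriv hsv e) hg hsg sB (contDiffOn_heatExt sd.continuous td)
    (fun x hx => by
      rw [spaceLaplacian_heatExt (contDiff_lineDeriv_of_contDiff hv e)
        (hasCompactSupport_lineDeriv hsv e) hx, lineDeriv_heatExt (sd.of_le (by simp)) td e hx,
        funext (planeLaplacian_lineDeriv hv · e), hΔd])
    (fun x hx => by
      rw [hd, heatExt_add sd₁.continuous td₁ sd₂.continuous td₂ hx,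
        ← lineDeriv_heatExt (hf₁.of_le (by simp)) hs₁ 1 hx,
        ← lineDeriv_heatExt (hf₂.of_le (by simp)) hs₂ I hx]
      exact abs_mul_le_heatOp_bellman hr sW hWpos s₁ s₂ s₃ hx (lineDeriv_heatExt_time cω tω hx)
        (lineDeriv_heatExt_time hf₁.continuous hs₁ hx)
        (lineDeriv_heatExt_time hf₂.continuous hs₂ hx) (lineDeriv_heatExt_time hg hsg hx)
        (d₁ x hx) (d₂ x hx) (d₃ x hx) he)
    B0 Bi BK (fun x hx => abs_heatExt_le_of_bound hM hx)
  refine res.trans ?_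
  rw [mul_assoc, mul_assoc]
  exact mul_le_mul_of_nonneg_left (mul_le_mul_of_nonneg_left hωr hCb0.le) zero_le_two

section Power

variable {p : ℝ}

lemma continuous_abs_rpow_mul_self (hp : 1 < p) : Continuous fun x : ℝ => |x| ^ (p - 2) * x := by
  have h := (contDiff_norm_rpow (E := ℝ) hp).continuous_deriv le_rfl
  have e : deriv (fun x : ℝ => ‖x‖ ^ p) = fun x => p * (|x| ^ (p - 2) * x) := funext fun x => by
    rw [(hasDerivAt_norm_rpow x hp).deriv, Real.norm_eq_abs, mul_assoc]
  rw [e] at h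
  have h2 := h.const_mul p⁻¹
  simpa [← mul_assoc, inv_mul_cancel₀ (show p ≠ 0 by linarith)] using h2

lemma abs_abs_rpow_mul_self (hp : 1 < p) (x : ℝ) : |(|x| ^ (p - 2) * x)| = |x| ^ (p - 1) := by
  rw [abs_mul, abs_of_nonneg (by positivity)]
  rcases eq_or_ne x 0 with rfl | hx
  · rw [abs_zero, mul_zero, Real.zero_rpow (by linarith)]
  · nth_rewrite 2 [← Real.rpow_one |x|]
    rw [← Real.rpow_add (abs_pos.2 hx)]
    ring_nf

lemma rpow_sub_one_mul_self (hp : 1 < p) {x : ℝ} (hx : 0 ≤ x) : x ^ (p - 1) * x = x ^ p := by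
  rcases hx.eq_or_lt with rfl | hx
  · rw [mul_zero, Real.zero_rpow (by linarith)]
  · nth_rewrite 2 [← Real.rpow_one x]
    rw [← Real.rpow_add hx]
    ring_nf

lemma mul_abs_rpow_mul_self (hp : 1 < p) (x : ℝ) : x * (|x| ^ (p - 2) * x) = |x| ^ p := by
  rcases eq_or_ne x 0 with rfl | hx
  · rw [zero_mul, abs_zero, Real.zero_rpow (by linarith)]
  · have e : x * (|x| ^ (p - 2) * x) = |x| ^ (p - 2) * |x| ^ (2 : ℝ) := by
      rw [Real.rpow_two, sq_abs]
      ring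
    rw [e, ← Real.rpow_add (abs_pos.2 hx)]
    ring_nf

lemma rpow_sub_one_mul_le (hp : 1 < p) {x y ε : ℝ} (hx : 0 ≤ x) (hy : 0 ≤ y) (hε : 0 < ε) :
    x ^ (p - 1) * y ≤ ε * x ^ p + (ε ^ (p - 1))⁻¹ * y ^ p := by
  rcases le_total y (ε * x) with h | h
  · have h1 : x ^ (p - 1) * y ≤ x ^ (p - 1) * (ε * x) :=
      mul_le_mul_of_nonneg_left h (by positivity)
    have h2 : x ^ (p - 1) * (ε * x) = ε * x ^ p := by
      rw [← rpow_sub_one_mul_self hp hx]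
      ring
    have : 0 ≤ (ε ^ (p - 1))⁻¹ * y ^ p := by positivity
    linarith
  · have h1 : ε ^ (p - 1) * x ^ (p - 1) ≤ y ^ (p - 1) := by
      rw [← Real.mul_rpow hε.le hx]
      exact Real.rpow_le_rpow (by positivity) h (by linarith)
    have h2 : x ^ (p - 1) ≤ (ε ^ (p - 1))⁻¹ * y ^ (p - 1) := by
      rwa [le_inv_mul_iff₀ (by positivity)]
    have h3 := mul_le_mul_of_nonneg_right h2 hy
    rw [mul_assoc, rpow_sub_one_mul_self hp hy] at h3
    have : 0 ≤ ε * x ^ p := by positivity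
    linarith

end Power

/-- `L^p` bound for the gradient of a solution of `Δ v = ∂ₛ f₁ + ∂ₜ f₂`. -/
lemma exists_integral_abs_lineDeriv_rpow_le {p : ℝ} (hp : 1 < p) :
    ∃ C : ℝ, 0 < C ∧ ∀ v f₁ f₂ : ℂ → ℝ, ContDiff ℝ (⊤ : ℕ∞) v → HasCompactSupport v →
      ContDiff ℝ (⊤ : ℕ∞) f₁ → HasCompactSupport f₁ → ContDiff ℝ (⊤ : ℕ∞) f₂ →
      HasCompactSupport f₂ →
      (∀ z, planeLaplacian v z = lineDeriv ℝ f₁ z 1 + lineDeriv ℝ f₂ z I) →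
      ∀ e : ℂ, e = 1 ∨ e = I → ∫ z, |lineDeriv ℝ v z e| ^ p ≤
        C * ((∫ z, |f₁ z| ^ p) + ∫ z, |f₂ z| ^ p) := by
  have hpq := Real.HolderConjugate.conjExponent hp
  set q := p.conjExponent
  have hq : 0 < q - 1 := by linarith [hpq.symm.lt]
  obtain ⟨C, hC, H⟩ := exists_integral_lineDeriv_mul_le hpq
  set t : ℝ := (2 * C)⁻¹ ^ (q - 1)⁻¹ with ht
  have ht0 : 0 < t := by positivity
  have htq : C * t ^ q = t / 2 := by
    rw [← rpow_sub_one_mul_self hpq.symm.lt ht0.le, ht, ← Real.rpow_mul (by positivity),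
      inv_mul_cancel₀ hq.ne', Real.rpow_one]
    field_simp
  refine ⟨C * 2 / t, by positivity, ?_⟩
  intro v f₁ f₂ hv hsv hf₁ hs₁ hf₂ hs₂ hΔ e he
  have ch := (contDiff_lineDeriv_of_contDiff hv e).continuous
  have sh := hasCompactSupport_lineDeriv hsv e
  have main := H v f₁ f₂ (fun z => t * (|lineDeriv ℝ v z e| ^ (p - 2) * lineDeriv ℝ v z e)) hv hsv
    hf₁ hs₁ hf₂ hs₂ (((continuous_abs_rpow_mul_self hp).comp ch).const_mul t)
    (sh.mul_left.mul_left) hΔ e he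
  have e1 : ∀ z, lineDeriv ℝ v z e * (t * (|lineDeriv ℝ v z e| ^ (p - 2) * lineDeriv ℝ v z e)) =
      t * |lineDeriv ℝ v z e| ^ p := fun z => by
    rw [← mul_abs_rpow_mul_self hp (lineDeriv ℝ v z e)]
    ring
  have e2 : ∀ z, |t * (|lineDeriv ℝ v z e| ^ (p - 2) * lineDeriv ℝ v z e)| ^ q =
      t ^ q * |lineDeriv ℝ v z e| ^ p := fun z => by
    rw [abs_mul, abs_abs_rpow_mul_self hp, abs_of_pos ht0, Real.mul_rpow ht0.le (by positivity),
      ← Real.rpow_mul (abs_nonneg _), hpq.sub_one_mul_conj]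
  simp only [e1, e2, integral_const_mul] at main
  rw [mul_add, ← mul_assoc C (t ^ q), htq] at main
  rw [div_mul_eq_mul_div, le_div_iff₀ ht0]
  linarith

lemma lineDeriv_abs_rpow {p : ℝ} (hp : 1 < p) {a : ℂ → ℝ} (ha : ContDiff ℝ 1 a) (z e : ℂ) :
    lineDeriv ℝ (fun y => |a y| ^ p) z e = p * |a z| ^ (p - 2) * a z * lineDeriv ℝ a z e := by
  have hl : HasDerivAt (fun s : ℝ => a (z + s • e)) (lineDeriv ℝ a z e) 0 :=
    ((ha.differentiable (by simp)) z).lineDifferentiableAt.hasLineDerivAt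
  have h := (hasDerivAt_abs_rpow (a (z + (0 : ℝ) • e)) hp).comp (0 : ℝ) hl
  rw [zero_smul, add_zero] at h
  exact h.deriv

/-- Poincaré inequality on the unit disc. -/
lemma integral_abs_rpow_le_of_tsupport_subset_ball {p : ℝ} (hp : 1 < p) {a : ℂ → ℝ}
    (ha : ContDiff ℝ 1 a) (hs : HasCompactSupport a) (hb : tsupport a ⊆ ball 0 1) :
    ∫ z, |a z| ^ p ≤ 2 * p * ((2 * p)⁻¹ ^ (p - 1))⁻¹ * ∫ z, |lineDeriv ℝ a z 1| ^ p := by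
  have hp0 : 0 < p := by linarith
  have hre : ∀ z, lineDeriv ℝ (fun y : ℂ => y.re) z 1 = 1 := fun z =>
    ((reCLM.hasFDerivAt (x := z)).hasLineDerivAt 1).lineDeriv
  have hpow : ContDiff ℝ 1 fun z => |a z| ^ p := ha.norm_rpow hp
  have ibp := integral_mul_lineDeriv hpow (hasCompactSupport_abs_rpow hs hp0)
    (g := fun y : ℂ => y.re) reCLM.contDiff 1
  simp only [hre, mul_one, lineDeriv_abs_rpow hp ha] at ibp
  have cd := continuous_lineDeriv_of_contDiff ha 1
  have sd := hasCompactSupport_lineDeriv hs 1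
  have ia := integrable_abs_rpow ha.continuous hs hp0
  have id := integrable_abs_rpow cd sd hp0
  have cp : Continuous fun z => |a z| ^ (p - 2) * a z :=
    (continuous_abs_rpow_mul_self hp).comp ha.continuous
  have il : Integrable fun z => p * |a z| ^ (p - 2) * a z * lineDeriv ℝ a z 1 * z.re := by
    have c : Continuous fun z => p * (|a z| ^ (p - 2) * a z) * lineDeriv ℝ a z 1 * z.re :=
      ((cp.const_mul p).mul cd).mul continuous_re
    simp only [← mul_assoc] at c
    exact c.integrable_of_hasCompactSupport sd.mul_left.mul_right
  set R := ((2 * p)⁻¹ ^ (p - 1))⁻¹ with hR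
  have bd : ∫ z, |a z| ^ p ≤ ∫ z, (2⁻¹ * |a z| ^ p + p * R * |lineDeriv ℝ a z 1| ^ p) := by
    rw [ibp, ← integral_neg]
    refine integral_mono il.neg ((ia.const_mul _).add (id.const_mul _)) fun z => ?_
    refine (neg_le_abs _).trans ?_
    have y := rpow_sub_one_mul_le hp (abs_nonneg (a z)) (abs_nonneg (lineDeriv ℝ a z 1))
      (ε := (2 * p)⁻¹) (by positivity)
    have y' := mul_le_mul_of_nonneg_left y hp0.le
    have e1 : p * ((2 * p)⁻¹ * |a z| ^ p + R * |lineDeriv ℝ a z 1| ^ p) =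
        2⁻¹ * |a z| ^ p + p * R * |lineDeriv ℝ a z 1| ^ p := by
      field_simp
    rw [e1] at y'
    refine le_trans ?_ y'
    rw [mul_assoc p, abs_mul, abs_mul, abs_mul, abs_abs_rpow_mul_self hp, abs_of_pos hp0]
    by_cases hz : z ∈ tsupport a
    · have h1 : |z.re| ≤ 1 := (abs_re_le_norm z).trans (mem_ball_zero_iff.1 (hb hz)).le
      rw [mul_assoc p]
      exact mul_le_of_le_one_right (by positivity) h1
    · have : a z = 0 := image_eq_zero_of_notMem_tsupport hz
      rw [this, abs_zero, Real.zero_rpow (by linarith)]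
      simp
  rw [integral_add (ia.const_mul _) (id.const_mul _), integral_const_mul, integral_const_mul] at bd
  linarith

lemma lineDeriv_sub_plane {f g : ℂ → ℝ} (hf : ContDiff ℝ 1 f) (hg : ContDiff ℝ 1 g) (z e : ℂ) :
    lineDeriv ℝ (fun y => f y - g y) z e = lineDeriv ℝ f z e - lineDeriv ℝ g z e := by
  rw [lineDeriv_eq_fderiv_of_contDiff (hf.sub hg), lineDeriv_eq_fderiv_of_contDiff hf,
    lineDeriv_eq_fderiv_of_contDiff hg, fderiv_fun_sub (hf.differentiable (by simp) z)
    (hg.differentiable (by simp) z)]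
  rfl

/-- The scalar Calderón–Zygmund inequality for `∂̄ (a + i b)`, written in real and imaginary
parts. -/
lemma exists_integral_rpow_le_of_re_im {p : ℝ} (hp : 1 < p) :
    ∃ C : ℝ, 0 < C ∧ ∀ a b : ℂ → ℝ, ContDiff ℝ (⊤ : ℕ∞) a → HasCompactSupport a →
      tsupport a ⊆ ball 0 1 → ContDiff ℝ (⊤ : ℕ∞) b → HasCompactSupport b →
      tsupport b ⊆ ball 0 1 → ∀ S : ℝ,
      ∫ z, |lineDeriv ℝ a z 1 - lineDeriv ℝ b z I| ^ p ≤ S →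
      ∫ z, |lineDeriv ℝ b z 1 + lineDeriv ℝ a z I| ^ p ≤ S →
      ∀ k, k = a ∨ k = b → ∫ z, |k z| ^ p ≤ C * S ∧
        ∀ e : ℂ, e = 1 ∨ e = I → ∫ z, |lineDeriv ℝ k z e| ^ p ≤ C * S := by
  obtain ⟨C, hC, H⟩ := exists_integral_abs_lineDeriv_rpow_le hp
  set P := 2 * p * ((2 * p)⁻¹ ^ (p - 1))⁻¹ with hP
  have hP0 : 0 < P := by positivity
  refine ⟨C * 2 + P * (C * 2), by positivity, ?_⟩
  intro a b ha sa ta hb sb tb S h₁ h₂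
  have da := contDiff_lineDeriv_of_contDiff ha
  have db := contDiff_lineDeriv_of_contDiff hb
  have ca := hasCompactSupport_lineDeriv sa
  have cb := hasCompactSupport_lineDeriv sb
  have oa : ∀ e, ContDiff ℝ 1 fun z => lineDeriv ℝ a z e := fun e => (da e).of_le (by simp)
  have ob : ∀ e, ContDiff ℝ 1 fun z => lineDeriv ℝ b z e := fun e => (db e).of_le (by simp)
  have hS : 0 ≤ S := le_trans (by positivity) h₁
  have ga : ∀ e : ℂ, e = 1 ∨ e = I → ∫ z, |lineDeriv ℝ a z e| ^ p ≤ C * 2 * S := fun e he => by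
    refine (H a (fun z => lineDeriv ℝ a z 1 - lineDeriv ℝ b z I)
      (fun z => lineDeriv ℝ b z 1 + lineDeriv ℝ a z I) ha sa ((da 1).sub (db I))
      ((ca 1).sub (cb I)) ((db 1).add (da I)) ((cb 1).add (ca I)) (fun z => ?_) e he).trans ?_
    · rw [lineDeriv_sub_plane (oa 1) (ob I), lineDeriv_add_plane (ob 1) (oa I),
        lineDeriv_lineDeriv_comm hb z 1 I, planeLaplacian]
      ring
    · rw [mul_assoc]
      exact mul_le_mul_of_nonneg_left (by linarith) hC.le
  have gb : ∀ e : ℂ, e = 1 ∨ e = I → ∫ z, |lineDeriv ℝ b z e| ^ p ≤ C * 2 * S := fun e he => by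
    refine (H b (fun z => lineDeriv ℝ b z 1 + lineDeriv ℝ a z I)
      (fun z => lineDeriv ℝ b z I - lineDeriv ℝ a z 1) hb sb ((db 1).add (da I))
      ((cb 1).add (ca I)) ((db I).sub (da 1)) ((cb I).sub (ca 1)) (fun z => ?_) e he).trans ?_
    · rw [lineDeriv_sub_plane (ob I) (oa 1), lineDeriv_add_plane (ob 1) (oa I),
        lineDeriv_lineDeriv_comm ha z 1 I, planeLaplacian]
      ring
    · simp only [abs_sub_comm (lineDeriv ℝ b _ I)]
      rw [mul_assoc]
      exact mul_le_mul_of_nonneg_left (by linarith) hC.le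
  have wrap : ∀ k : ℂ → ℝ, ContDiff ℝ 1 k → HasCompactSupport k → tsupport k ⊆ ball 0 1 →
      (∀ e : ℂ, e = 1 ∨ e = I → ∫ z, |lineDeriv ℝ k z e| ^ p ≤ C * 2 * S) →
      ∫ z, |k z| ^ p ≤ (C * 2 + P * (C * 2)) * S ∧ ∀ e : ℂ, e = 1 ∨ e = I →
        ∫ z, |lineDeriv ℝ k z e| ^ p ≤ (C * 2 + P * (C * 2)) * S := by
    intro k hk sk tk g
    have n₁ : 0 ≤ C * 2 * S := by positivity
    have n₂ : 0 ≤ P * (C * 2 * S) := by positivity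
    have po := (integral_abs_rpow_le_of_tsupport_subset_ball hp hk sk tk).trans
      (mul_le_mul_of_nonneg_left (g 1 (Or.inl rfl)) hP0.le)
    rw [add_mul, mul_assoc P]
    exact ⟨by linarith, fun e he => by linarith [g e he]⟩
  rintro k (rfl | rfl)
  · exact wrap k (ha.of_le (by simp)) sa ta ga
  · exact wrap k (hb.of_le (by simp)) sb tb gb

section Vector

variable {n : ℕ} {p : ℝ}

lemma norm_euclidean_le_sum (x : EuclideanSpace ℂ (Fin n)) :
    ‖x‖ ≤ ∑ j, (|(x j).re| + |(x j).im|) := by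
  calc ‖x‖ = ‖∑ j, EuclideanSpace.single j (x j)‖ := by
        congr 1
        ext i
        simp
    _ ≤ ∑ j, ‖EuclideanSpace.single j (x j)‖ := norm_sum_le _ _
    _ ≤ _ := Finset.sum_le_sum fun j _ => by
        rw [PiLp.norm_single]
        exact norm_le_abs_re_add_abs_im _

lemma norm_euclidean_rpow_le (hp : 1 ≤ p) (x : EuclideanSpace ℂ (Fin n)) :
    ‖x‖ ^ p ≤ (n : ℝ) ^ (p - 1) *
      ∑ j, 3 ^ (p - 1) * (|(x j).re| ^ p + |(x j).im| ^ p) := by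
  refine (Real.rpow_le_rpow (norm_nonneg _) (norm_euclidean_le_sum x) (by linarith)).trans ?_
  refine (Real.rpow_sum_le_const_mul_sum_rpow_of_nonneg _ hp fun j _ => by positivity).trans ?_
  rw [Finset.card_univ, Fintype.card_fin]
  refine mul_le_mul_of_nonneg_left (Finset.sum_le_sum fun j _ => ?_) (by positivity)
  have h := add_add_rpow_le (abs_nonneg (x j).re) (abs_nonneg (x j).im) le_rfl hp
  simpa [Real.zero_rpow (show p ≠ 0 by linarith)] using h

lemma integrable_norm_rpow {E : Type*} [NormedAddCommGroup E] {φ : ℂ → E} (hφ : Continuous φ)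
    (hs : HasCompactSupport φ) (hp : 0 < p) : Integrable fun z => ‖φ z‖ ^ p := by
  have h := integrable_abs_rpow (f := fun z => ‖φ z‖) hφ.norm hs.norm hp
  simpa only [abs_norm] using h

lemma integral_norm_euclidean_rpow_le (hp : 1 ≤ p) {φ : ℂ → EuclideanSpace ℂ (Fin n)}
    (hφ : Continuous φ) (hs : HasCompactSupport φ) {A : ℝ}
    (hre : ∀ j, ∫ z, |(φ z j).re| ^ p ≤ A) (him : ∀ j, ∫ z, |(φ z j).im| ^ p ≤ A) :
    ∫ z, ‖φ z‖ ^ p ≤ (n : ℝ) ^ (p - 1) * (n * (3 ^ (p - 1) * 2)) * A := by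
  have hp0 : 0 < p := by linarith
  have ir : ∀ j, Integrable fun z => |(φ z j).re| ^ p := fun j =>
    integrable_abs_rpow (by fun_prop)
      (hs.comp_left (g := fun x : EuclideanSpace ℂ (Fin n) => (x j).re) (by simp)) hp0
  have ii : ∀ j, Integrable fun z => |(φ z j).im| ^ p := fun j =>
    integrable_abs_rpow (by fun_prop)
      (hs.comp_left (g := fun x : EuclideanSpace ℂ (Fin n) => (x j).im) (by simp)) hp0
  have ij : ∀ j ∈ Finset.univ, Integrable fun z =>
      3 ^ (p - 1) * (|(φ z j).re| ^ p + |(φ z j).im| ^ p) :=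
    fun j _ => ((ir j).add (ii j)).const_mul _
  refine (integral_mono (integrable_norm_rpow hφ hs hp0)
    ((integrable_finsetSum _ ij).const_mul _) fun z => norm_euclidean_rpow_le hp (φ z)).trans ?_
  rw [integral_const_mul, integral_finsetSum _ ij, mul_assoc]
  refine mul_le_mul_of_nonneg_left ?_ (by positivity)
  calc ∑ j, ∫ z, 3 ^ (p - 1) * (|(φ z j).re| ^ p + |(φ z j).im| ^ p)
      ≤ ∑ _j : Fin n, 3 ^ (p - 1) * (A + A) := Finset.sum_le_sum fun j _ => by
        rw [integral_const_mul, integral_add (ir j) (ii j)]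
        exact mul_le_mul_of_nonneg_left (add_le_add (hre j) (him j)) (by positivity)
    _ = n * (3 ^ (p - 1) * 2) * A := by
        rw [Finset.sum_const, Finset.card_univ, Fintype.card_fin, nsmul_eq_mul]
        ring

lemma norm_le_norm_one_add_norm_I {E : Type*} [NormedAddCommGroup E] [NormedSpace ℝ E]
    (T : ℂ →L[ℝ] E) : ‖T‖ ≤ ‖T 1‖ + ‖T I‖ := by
  refine T.opNorm_le_bound (by positivity) fun ζ => ?_
  have e : T ζ = ζ.re • T 1 + ζ.im • T I := by
    rw [← map_smul, ← map_smul, ← map_add]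
    congr 1
    simp [re_add_im]
  rw [e, add_mul]
  refine (norm_add_le _ _).trans (add_le_add ?_ ?_)
  · rw [norm_smul, mul_comm]
    exact mul_le_mul_of_nonneg_left (abs_re_le_norm ζ) (norm_nonneg _)
  · rw [norm_smul, mul_comm]
    exact mul_le_mul_of_nonneg_left (abs_im_le_norm ζ) (norm_nonneg _)

lemma lineDeriv_clm_comp {E : Type*} [NormedAddCommGroup E] [NormedSpace ℝ E] {u : ℂ → E}
    (hu : Differentiable ℝ u) (l : E →L[ℝ] ℝ) (z e : ℂ) :
    lineDeriv ℝ (fun y => l (u y)) z e = l (fderiv ℝ u z e) :=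
  ((l.hasFDerivAt.comp z (hu z).hasFDerivAt).hasLineDerivAt e).lineDeriv

/-- The `L^p` bounds for `u`, `∂ₛ u` and `∂ₜ u` in terms of `∂̄ u`. -/
lemma exists_integral_norm_rpow_le (n : ℕ) (hp : 1 < p) :
    ∃ K : ℝ, 0 ≤ K ∧ ∀ u : ℂ → EuclideanSpace ℂ (Fin n), ContDiff ℝ (⊤ : ℕ∞) u →
      HasCompactSupport u → tsupport u ⊆ ball 0 1 →
      ∫ z, ‖u z‖ ^ p ≤ K * ∫ z, ‖fderiv ℝ u z 1 + I • fderiv ℝ u z I‖ ^ p ∧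
      ∀ e : ℂ, e = 1 ∨ e = I → ∫ z, ‖fderiv ℝ u z e‖ ^ p ≤
        K * ∫ z, ‖fderiv ℝ u z 1 + I • fderiv ℝ u z I‖ ^ p := by
  obtain ⟨C, hC, H⟩ := exists_integral_rpow_le_of_re_im hp
  refine ⟨(n : ℝ) ^ (p - 1) * (n * (3 ^ (p - 1) * 2)) * C, by positivity, ?_⟩
  intro u hu su tu
  have hp0 : 0 < p := by linarith
  have du : Differentiable ℝ u := hu.differentiable (by simp)
  have cD : ∀ e, Continuous fun z => fderiv ℝ u z e := fun e =>
    (hu.continuous_fderiv (by simp)).clm_apply continuous_const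
  have sD : ∀ e, HasCompactSupport fun z => fderiv ℝ u z e := su.fderiv_apply ℝ
  set w : ℂ → EuclideanSpace ℂ (Fin n) := fun z => fderiv ℝ u z 1 + I • fderiv ℝ u z I with hw
  have iw := integrable_norm_rpow (p := p) (φ := w) ((cD 1).add ((cD I).const_smul I))
    ((sD 1).add ((sD I).smul_left (f := fun _ => I))) hp0
  set r : Fin n → EuclideanSpace ℂ (Fin n) →L[ℝ] ℝ := fun j =>
    reCLM.comp ((EuclideanSpace.proj (𝕜 := ℂ) j).restrictScalars ℝ) with hr
  set m : Fin n → EuclideanSpace ℂ (Fin n) →L[ℝ] ℝ := fun j =>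
    imCLM.comp ((EuclideanSpace.proj (𝕜 := ℂ) j).restrictScalars ℝ) with hm
  have comp : ∀ l : EuclideanSpace ℂ (Fin n) →L[ℝ] ℝ, ContDiff ℝ (⊤ : ℕ∞) (fun z => l (u z)) ∧
      HasCompactSupport (fun z => l (u z)) ∧ tsupport (fun z => l (u z)) ⊆ ball 0 1 := fun l =>
    ⟨l.contDiff.comp hu, su.comp_left (map_zero l),
      (closure_mono (Function.support_comp_subset (map_zero l) u)).trans tu⟩
  have bd : ∀ (f : ℂ → ℝ), Continuous f → HasCompactSupport f → (∀ z, |f z| ≤ ‖w z‖) →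
      ∫ z, |f z| ^ p ≤ ∫ z, ‖w z‖ ^ p := fun f cf sf hf =>
    integral_mono (integrable_abs_rpow cf sf hp0) iw fun z =>
      Real.rpow_le_rpow (abs_nonneg _) (hf z) hp0.le
  have coord : ∀ (x : EuclideanSpace ℂ (Fin n)) j, |(x j).re| ≤ ‖x‖ ∧ |(x j).im| ≤ ‖x‖ :=
    fun x j => ⟨(abs_re_le_norm _).trans (PiLp.norm_apply_le x j),
      (abs_im_le_norm _).trans (PiLp.norm_apply_le x j)⟩
  have main := fun j => H (fun z => r j (u z)) (fun z => m j (u z)) (comp (r j)).1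
    (comp (r j)).2.1 (comp (r j)).2.2 (comp (m j)).1 (comp (m j)).2.1 (comp (m j)).2.2
    (∫ z, ‖w z‖ ^ p)
    (by
      simp only [lineDeriv_clm_comp du]
      refine bd _ (((r j).continuous.comp (cD 1)).sub ((m j).continuous.comp (cD I)))
        (((sD 1).comp_left (map_zero (r j))).sub ((sD I).comp_left (map_zero (m j)))) fun z => ?_
      simpa [hr, hm, hw, sub_eq_add_neg] using (coord (w z) j).1)
    (by
      simp only [lineDeriv_clm_comp du]
      refine bd _ (((m j).continuous.comp (cD 1)).add ((r j).continuous.comp (cD I)))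
        (((sD 1).comp_left (map_zero (m j))).add ((sD I).comp_left (map_zero (r j)))) fun z => ?_
      simpa [hr, hm, hw] using (coord (w z) j).2)
  have mr := fun j => main j _ (Or.inl rfl)
  have mm := fun j => main j _ (Or.inr rfl)
  simp only [lineDeriv_clm_comp du] at mr mm
  refine ⟨?_, fun e he => ?_⟩
  · rw [mul_assoc]
    exact integral_norm_euclidean_rpow_le hp.le hu.continuous su (fun j => (mr j).1)
      fun j => (mm j).1
  · rw [mul_assoc]
    exact integral_norm_euclidean_rpow_le hp.le (cD e) (sD e) (fun j => (mr j).2 e he)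
      fun j => (mm j).2 e he

lemma rpow_one_div_le {A K S : ℝ} (hp : 0 < p) (hA : 0 ≤ A) (hK : 0 ≤ K) (hS : 0 ≤ S)
    (h : A ≤ K * S) : A ^ (1 / p) ≤ K ^ (1 / p) * S ^ (1 / p) := by
  rw [← Real.mul_rpow hK hS]
  exact Real.rpow_le_rpow hA h (by positivity)

end Vector

end HeatFlow

/-- **Calderón–Zygmund inequality.**  For each `1 < p < ∞` there is a constant `c > 0`
such that for every smooth `u : ℂ → ℂⁿ` with compact support contained in the open unit
ball `B`, one has `‖u‖_{L^p} + ‖Du‖_{L^p} ≤ c·‖∂̄u‖_{L^p}`, where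
`∂̄u = ∂ₛu + i·∂ₜu` and the `L^p` norms are with respect to Lebesgue measure on `ℂ`. -/
theorem calderon_zygmund_inequality (n : ℕ) (p : ℝ) (hp : 1 < p) :
    ∃ c : ℝ, 0 < c ∧ ∀ u : ℂ → EuclideanSpace ℂ (Fin n),
      ContDiff ℝ (⊤ : ℕ∞) u → HasCompactSupport u → tsupport u ⊆ ball 0 1 →
      (∫ z : ℂ, ‖u z‖ ^ p) ^ (1 / p) + (∫ z : ℂ, ‖fderiv ℝ u z‖ ^ p) ^ (1 / p) ≤
        c * (∫ z : ℂ,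
          ‖fderiv ℝ u z 1 + Complex.I • fderiv ℝ u z Complex.I‖ ^ p) ^ (1 / p) := by
  obtain ⟨K, hK, H⟩ := HeatFlow.exists_integral_norm_rpow_le n hp
  set L : ℝ := 3 ^ (p - 1) * (2 * K) with hL
  refine ⟨K ^ (1 / p) + L ^ (1 / p) + 1, by positivity, fun u hu su tu => ?_⟩
  have hp0 : 0 < p := by linarith
  obtain ⟨h₀, h₁⟩ := H u hu su tu
  set S := ∫ z : ℂ, ‖fderiv ℝ u z 1 + Complex.I • fderiv ℝ u z Complex.I‖ ^ p with hS
  have cD := hu.continuous_fderiv (by simp)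
  have i : ∀ e, Integrable fun z => ‖fderiv ℝ u z e‖ ^ p := fun e =>
    HeatFlow.integrable_norm_rpow (cD.clm_apply continuous_const) (su.fderiv_apply ℝ e) hp0
  have hD : ∫ z : ℂ, ‖fderiv ℝ u z‖ ^ p ≤ L * S := by
    refine (integral_mono (HeatFlow.integrable_norm_rpow cD (su.fderiv ℝ) hp0)
      (((i 1).add (i I)).const_mul (3 ^ (p - 1))) fun z => ?_).trans ?_
    · refine (Real.rpow_le_rpow (norm_nonneg _)
        (HeatFlow.norm_le_norm_one_add_norm_I (fderiv ℝ u z)) hp0.le).trans ?_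
      have h := HeatFlow.add_add_rpow_le (norm_nonneg (fderiv ℝ u z 1))
        (norm_nonneg (fderiv ℝ u z I)) le_rfl hp.le
      simpa [Real.zero_rpow hp0.ne'] using h
    · simp only [Pi.add_apply]
      rw [integral_const_mul, integral_add (i 1) (i I), hL, mul_assoc]
      refine mul_le_mul_of_nonneg_left ?_ (by positivity)
      linarith [h₁ 1 (Or.inl rfl), h₁ I (Or.inr rfl)]
  have hS0 : 0 ≤ S := by positivity
  have r₀ := HeatFlow.rpow_one_div_le hp0 (by positivity) hK hS0 h₀
  have r₁ := HeatFlow.rpow_one_div_le hp0 (by positivity) (by positivity) hS0 hD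
  have : 0 ≤ S ^ (1 / p) := by positivity
  rw [add_mul, add_mul]
  linarith
end

section
/- The Cauchy transform inverts ∂̄ on test functions: For every smooth compactly supported function f : ℂ → ℂⁿ, the function Tf defined by Tf(z) := (1/(2π)) ∫_ℂ (z − ζ)⁻¹ · f(ζ) dλ(ζ) (the integrand being the complex scalar 1/(z−ζ) times f(ζ), defined for ζ ≠ z) is a well-defined smooth function ℂ → ℂⁿ which tends to 0 as |z| → ∞ and satisfies ∂ₛ(Tf)(z) + i·∂ₜ(Tf)(z) = f(z) for all z ∈ ℂ. -/
open Metric Complex MeasureTheory Filter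

section CauchyTransform

open scoped Convolution

variable {E : Type*} [NormedAddCommGroup E]

lemma integrableOn_polarCoord_target_of_continuous {F : ℝ × ℝ → E} (hF : Continuous F) {R : ℝ}
    (hR : ∀ p : ℝ × ℝ, R < p.1 → F p = 0) : IntegrableOn F polarCoord.target := by
  have hK : IsCompact (Set.Icc 0 R ×ˢ Set.Icc (-Real.pi) Real.pi) :=
    isCompact_Icc.prod isCompact_Icc
  refine (hF.continuousOn.integrableOn_compact hK).of_forall_sdiff_eq_zero
    polarCoord.open_target.measurableSet ?_
  rintro ⟨r, θ⟩ ⟨⟨hr, hθ⟩, hn⟩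
  refine hR _ (not_le.1 fun h => hn ⟨⟨le_of_lt hr, h⟩, ⟨hθ.1.le, hθ.2.le⟩⟩)

lemma Complex.locallyIntegrable_inv : LocallyIntegrable (fun z : ℂ => z⁻¹) := by
  refine locallyIntegrable_of_norm_le_rpow (C := 1) (α := 1) (by simp) (by simp) ?_
    measurable_inv.aestronglyMeasurable
  exact Eventually.of_forall fun x => by simp [Real.rpow_neg_one]

lemma exists_forall_lt_norm_eq_zero {g : ℂ → E} (hg : HasCompactSupport g) :
    ∃ R : ℝ, ∀ z, R < ‖z‖ → g z = 0 := by
  obtain ⟨R, -, h⟩ := hg.exists_pos_le_norm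
  exact ⟨R, fun z hz => h z hz.le⟩

variable [NormedSpace ℝ E]

lemma hasDerivAt_comp_ofReal_mul {g : ℂ → E} (hg : Differentiable ℝ g) (e : ℂ) (r : ℝ) :
    HasDerivAt (fun s : ℝ => g (s * e)) (fderiv ℝ g (r * e) e) r := by
  have h : HasDerivAt (fun s : ℝ => (s : ℂ) * e) e r := by
    simpa using (ofRealCLM.hasDerivAt (x := r)).mul_const e
  exact (hg _).hasFDerivAt.comp_hasDerivAt r h

lemma hasDerivAt_comp_mul_exp_mul_I {g : ℂ → E} (hg : Differentiable ℝ g) (r θ : ℝ) :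
    HasDerivAt (fun t : ℝ => g (r * exp (t * I)))
      (r • fderiv ℝ g (r * exp (θ * I)) (I * exp (θ * I))) θ := by
  have h : HasDerivAt (fun t : ℝ => (r : ℂ) * exp (t * I)) (r • (I * exp (θ * I))) θ := by
    have h₁ : HasDerivAt (fun t : ℝ => (t : ℂ) * I) I θ := by
      simpa using (ofRealCLM.hasDerivAt (x := θ)).mul_const I
    simpa [mul_comm] using (h₁.cexp).const_mul (r : ℂ)
  rw [← map_smul]
  exact (hg _).hasFDerivAt.comp_hasDerivAt θ h

lemma integral_Ioi_fderiv_comp_ofReal_mul [CompleteSpace E] {g : ℂ → E} (hg : ContDiff ℝ 1 g)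
    (hgc : HasCompactSupport g) {e : ℂ} (he : ‖e‖ = 1) :
    ∫ r in Set.Ioi (0 : ℝ), fderiv ℝ g (r * e) e = -g 0 := by
  obtain ⟨R, hR⟩ := exists_forall_lt_norm_eq_zero hgc
  have hsm : ContDiff ℝ 1 (fun r : ℝ => g (r * e)) :=
    hg.comp (ofRealCLM.contDiff.mul contDiff_const)
  have hc : HasCompactSupport (fun r : ℝ => g (r * e)) := by
    refine HasCompactSupport.intro (isCompact_closedBall (0 : ℝ) R) fun r hr => hR _ ?_
    simpa [he] using hr
  have := hc.integral_Ioi_deriv_eq hsm 0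
  simpa [(hasDerivAt_comp_ofReal_mul (hg.differentiable one_ne_zero) e _).deriv] using this

lemma integral_Ioo_fderiv_comp_mul_exp [CompleteSpace E] {g : ℂ → E} (hg : ContDiff ℝ 1 g)
    {r : ℝ} (hr : r ≠ 0) :
    ∫ θ in Set.Ioo (-Real.pi) Real.pi, fderiv ℝ g (r * exp (θ * I)) (I * exp (θ * I)) = 0 := by
  have hcont : Continuous fun θ : ℝ => fderiv ℝ g (r * exp (θ * I)) (I * exp (θ * I)) :=
    ((hg.continuous_fderiv one_ne_zero).comp (by fun_prop)).clm_apply (by fun_prop)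
  have h := intervalIntegral.integral_eq_sub_of_hasDerivAt
    (fun θ _ => hasDerivAt_comp_mul_exp_mul_I (hg.differentiable one_ne_zero) r θ)
    ((hcont.const_smul r).intervalIntegrable (-Real.pi) Real.pi)
  rw [← integral_Ioc_eq_integral_Ioo,
    ← intervalIntegral.integral_of_le (by linarith [Real.pi_pos])]
  have hexp : exp (-(Real.pi * I)) = exp (Real.pi * I) := by
    rw [exp_neg, exp_pi_mul_I]; norm_num
  rw [intervalIntegral.integral_smul] at h
  simpa [hexp, hr] using h

variable [NormedSpace ℂ E]

lemma tendsto_integral_sub_inv_smul {f : ℂ → E} (hf : Continuous f) (hfc : HasCompactSupport f) :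
    Tendsto (fun z : ℂ => ∫ ζ : ℂ, (z - ζ)⁻¹ • f ζ) (cocompact ℂ) (nhds 0) := by
  obtain ⟨R, hR⟩ := exists_forall_lt_norm_eq_zero hfc
  have hlim : Tendsto (fun z : ℂ => (‖z‖ - R)⁻¹ * ∫ ζ, ‖f ζ‖) (cocompact ℂ) (nhds 0) := by
    have h : Tendsto (fun z : ℂ => ‖z‖ - R) (cocompact ℂ) atTop :=
      tendsto_atTop_add_const_right _ _ (tendsto_norm_cocompact_atTop (E := ℂ))
    simpa using h.inv_tendsto_atTop.mul_const (∫ ζ, ‖f ζ‖)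
  refine squeeze_zero_norm' ?_ hlim
  filter_upwards [(tendsto_norm_cocompact_atTop (E := ℂ)).eventually_gt_atTop R] with z hz
  rw [← integral_const_mul]
  refine norm_integral_le_of_norm_le
    ((hf.integrable_of_hasCompactSupport hfc).norm.const_mul _) (Eventually.of_forall fun ζ => ?_)
  rcases lt_or_ge R ‖ζ‖ with h | h
  · simp [hR ζ h]
  · rw [norm_smul, norm_inv]
    have := norm_sub_norm_le z ζ
    gcongr
    linarith

variable [IsScalarTower ℝ ℂ E]

lemma inv_smul_dbar_eq (D : ℂ →L[ℝ] E) {e : ℂ} (he : ‖e‖ = 1) :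
    e⁻¹ • (D 1 + I • D I) = D e + I • D (I * e) := by
  have hD : ∀ w : ℂ, D w = (w.re : ℂ) • D 1 + (w.im : ℂ) • D I := fun w => by
    conv_lhs => rw [show w = w.re • (1 : ℂ) + w.im • I by simp [re_add_im]]
    rw [map_add, map_smul, map_smul, ← algebraMap_smul ℂ, ← algebraMap_smul ℂ w.im]
    rfl
  have hinv : e⁻¹ = e.re - e.im * I := by
    rw [inv_def, normSq_eq_norm_sq, he]
    apply Complex.ext <;> simp
  rw [hD e, hD (I * e), hinv]
  have hI : I * I = -1 := I_mul_I
  simp only [mul_re, mul_im, I_re, I_im, zero_mul, one_mul, zero_sub, zero_add, ofReal_neg]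
  match_scalars
  · ring
  · linear_combination (-(e.im : ℂ)) * hI

/-- **Cauchy–Pompeiu formula** for compactly supported functions. -/
theorem integral_inv_smul_dbar [CompleteSpace E] {g : ℂ → E} (hg : ContDiff ℝ 1 g)
    (hgc : HasCompactSupport g) :
    ∫ z : ℂ, z⁻¹ • (fderiv ℝ g z 1 + I • fderiv ℝ g z I) = -((2 * Real.pi) • g 0) := by
  obtain ⟨R, hR⟩ := exists_forall_lt_norm_eq_zero (hgc.fderiv ℝ)
  set A : ℝ × ℝ → E := fun p => fderiv ℝ g (p.1 * exp (p.2 * I)) (exp (p.2 * I)) with hA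
  set B : ℝ × ℝ → E := fun p => fderiv ℝ g (p.1 * exp (p.2 * I)) (I * exp (p.2 * I)) with hB
  have hD := hg.continuous_fderiv one_ne_zero
  have hzero : ∀ p : ℝ × ℝ, R < p.1 → fderiv ℝ g (p.1 * exp (p.2 * I)) = 0 := fun p hp => by
    refine hR _ ?_
    rw [norm_mul, norm_exp_ofReal_mul_I, mul_one, norm_real]
    exact hp.trans_le (le_abs_self _)
  have hAi : IntegrableOn A polarCoord.target :=
    integrableOn_polarCoord_target_of_continuous
      ((hD.comp (by fun_prop)).clm_apply (by fun_prop)) (R := R)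
      fun p hp => by simp [hA, hzero p hp]
  have hBi : IntegrableOn B polarCoord.target :=
    integrableOn_polarCoord_target_of_continuous
      ((hD.comp (by fun_prop)).clm_apply (by fun_prop)) (R := R)
      fun p hp => by simp [hB, hzero p hp]
  have hAint : ∫ p in polarCoord.target, A p = -((2 * Real.pi) • g 0) := by
    rw [polarCoord_target] at hAi ⊢
    rw [Measure.volume_eq_prod, ← setIntegral_prod_swap]
    refine (setIntegral_prod _ hAi.swap).trans ?_
    simp only [hA, Function.comp_apply, Prod.fst_swap, Prod.snd_swap]
    simp_rw [integral_Ioi_fderiv_comp_ofReal_mul hg hgc (norm_exp_ofReal_mul_I _)]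
    rw [setIntegral_const, Real.volume_real_Ioo_of_le (by linarith [Real.pi_pos]), smul_neg]
    congr 2
    ring
  have hBint : ∫ p in polarCoord.target, B p = 0 := by
    rw [polarCoord_target] at hBi ⊢
    rw [Measure.volume_eq_prod, setIntegral_prod _ hBi]
    exact setIntegral_eq_zero_of_forall_eq_zero fun r hr =>
      integral_Ioo_fderiv_comp_mul_exp hg (ne_of_gt hr)
  calc ∫ z : ℂ, z⁻¹ • (fderiv ℝ g z 1 + I • fderiv ℝ g z I)
      = ∫ p in polarCoord.target, (A p + I • B p) := by
        rw [← Complex.integral_comp_polarCoord_symm]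
        refine setIntegral_congr_fun polarCoord.open_target.measurableSet ?_
        rintro ⟨r, θ⟩ ⟨hr, -⟩
        have hr' : (r : ℂ) ≠ 0 := ofReal_ne_zero.2 (ne_of_gt hr)
        have hsymm : Complex.polarCoord.symm (r, θ) = r * exp (θ * I) := by
          simp [exp_mul_I]
        simp only [hA, hB, hsymm]
        rw [← inv_smul_dbar_eq _ (norm_exp_ofReal_mul_I θ), mul_inv, mul_smul,
          ← algebraMap_smul ℂ r, coe_algebraMap, smul_inv_smul₀ hr']
    _ = -((2 * Real.pi) • g 0) := by
        refine (integral_add hAi (hBi.smul I)).trans ?_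
        simp only [Pi.smul_apply]
        rw [integral_smul, hAint, hBint, smul_zero, add_zero]

lemma integral_sub_inv_smul_eq_convolution (f : ℂ → E) :
    (fun z : ℂ => ∫ ζ : ℂ, (z - ζ)⁻¹ • f ζ) =
      (fun z : ℂ => z⁻¹) ⋆[ContinuousLinearMap.lsmul ℝ ℂ, volume] f := by
  ext z
  rw [convolution_def, ← integral_sub_left_eq_self _ volume z]
  simp

lemma integrable_sub_inv_smul {f : ℂ → E} (hf : Continuous f) (hfc : HasCompactSupport f)
    (z : ℂ) : Integrable (fun ζ : ℂ => (z - ζ)⁻¹ • f ζ) := by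
  have h := hfc.convolutionExists_right (ContinuousLinearMap.lsmul ℝ ℂ)
    Complex.locallyIntegrable_inv hf z
  simpa using h.integrable.comp_sub_left z

lemma dbar_integral_sub_inv_smul [CompleteSpace E] {f : ℂ → E} (hf : ContDiff ℝ 1 f)
    (hfc : HasCompactSupport f) (z : ℂ) :
    fderiv ℝ (fun w : ℂ => ∫ ζ : ℂ, (w - ζ)⁻¹ • f ζ) z 1 +
      I • fderiv ℝ (fun w : ℂ => ∫ ζ : ℂ, (w - ζ)⁻¹ • f ζ) z I = (2 * Real.pi) • f z := by
  have hloc := Complex.locallyIntegrable_inv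
  have hDi := (hfc.fderiv ℝ).convolutionExists_right
    ((ContinuousLinearMap.lsmul ℝ ℂ : ℂ →L[ℝ] E →L[ℝ] E).precompR ℂ) hloc
    (hf.continuous_fderiv one_ne_zero) z
  have happ : ∀ v : ℂ, fderiv ℝ (fun w : ℂ => ∫ ζ : ℂ, (w - ζ)⁻¹ • f ζ) z v =
      ∫ t : ℂ, t⁻¹ • fderiv ℝ f (z - t) v := fun v => by
    rw [integral_sub_inv_smul_eq_convolution,
      (hfc.hasFDerivAt_convolution_right _ hloc hf z).fderiv, convolution_def,
      ContinuousLinearMap.integral_apply hDi.integrable]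
    simp
  have hint : ∀ v : ℂ, Integrable fun t : ℂ => t⁻¹ • fderiv ℝ f (z - t) v := fun v => by
    simpa using hDi.integrable.apply_continuousLinearMap v
  have hcp := integral_inv_smul_dbar (g := fun t => f (z - t))
    (hf.comp (contDiff_const.sub contDiff_id))
    (hfc.comp_homeomorph (Homeomorph.subLeft z))
  have hfd : ∀ t, fderiv ℝ (fun t => f (z - t)) t = -fderiv ℝ f (z - t) := fun t => by
    have h := ((hf.differentiable one_ne_zero) (z - t)).hasFDerivAt.comp t
      ((hasFDerivAt_id t).const_sub z)
    simpa [Function.comp_def] using h.fderiv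
  simp only [hfd, neg_apply, smul_neg, ← neg_add, sub_zero, integral_neg,
    neg_inj] at hcp
  rw [happ, happ, ← integral_smul, ← hcp]
  refine (integral_add (hint 1) ((hint I).smul I)).symm.trans ?_
  congr 1 with t
  rw [smul_add, Pi.smul_apply, smul_comm]

end CauchyTransform

/-- **The Cauchy transform inverts `∂̄` on test functions.**  For every smooth compactly
supported `f : ℂ → ℂⁿ`, the function `Tf(z) = (1/2π) ∫_ℂ (z−ζ)⁻¹·f(ζ) dλ(ζ)` is a
well-defined smooth function which tends to `0` at infinity and satisfies
`∂ₛ(Tf) + i·∂ₜ(Tf) = f`. -/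
theorem cauchy_transform_inverts_dbar (n : ℕ) (f : ℂ → EuclideanSpace ℂ (Fin n))
    (hfsmooth : ContDiff ℝ (⊤ : ℕ∞) f)
    (hfsupp : HasCompactSupport f) :
    (∀ z : ℂ, Integrable (fun ζ : ℂ => (z - ζ)⁻¹ • f ζ)) ∧
    ContDiff ℝ (⊤ : ℕ∞)
      (fun z : ℂ => (2 * Real.pi)⁻¹ • ∫ ζ : ℂ, (z - ζ)⁻¹ • f ζ) ∧
    Tendsto (fun z : ℂ => (2 * Real.pi)⁻¹ • ∫ ζ : ℂ, (z - ζ)⁻¹ • f ζ)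
      (cocompact ℂ) (nhds 0) ∧
    ∀ z : ℂ,
      fderiv ℝ (fun w : ℂ => (2 * Real.pi)⁻¹ • ∫ ζ : ℂ, (w - ζ)⁻¹ • f ζ) z 1 +
        Complex.I •
          fderiv ℝ (fun w : ℂ => (2 * Real.pi)⁻¹ • ∫ ζ : ℂ, (w - ζ)⁻¹ • f ζ) z
            Complex.I
        = f z := by
  have hloc := Complex.locallyIntegrable_inv
  have hf1 : ContDiff ℝ 1 f := hfsmooth.of_le (by exact_mod_cast le_top)
  have hsm : ContDiff ℝ (⊤ : ℕ∞) (fun z : ℂ => ∫ ζ : ℂ, (z - ζ)⁻¹ • f ζ) := by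
    rw [integral_sub_inv_smul_eq_convolution]
    exact hfsupp.contDiff_convolution_right _ hloc hfsmooth
  refine ⟨integrable_sub_inv_smul hf1.continuous hfsupp, hsm.const_smul _, ?_, fun z => ?_⟩
  · simpa using (tendsto_integral_sub_inv_smul hf1.continuous hfsupp).const_smul (2 * Real.pi)⁻¹
  · have hd : DifferentiableAt ℝ (fun z : ℂ => ∫ ζ : ℂ, (z - ζ)⁻¹ • f ζ) z :=
      hsm.differentiable (by simp) z
    rw [fderiv_fun_const_smul hd]
    simp only [smul_apply]
    rw [smul_comm Complex.I, ← smul_add, dbar_integral_sub_inv_smul hf1 hfsupp,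
      inv_smul_smul₀ (by positivity)]
end
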